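/- arXiv:math/0601471 — 2 statements merged into one kernel-verified Lean document; each statement's English description precedes it below -/
import Mathlib

section
/- For all 1 ≤ i, j ≤ n and all m, p ∈ ℤ, the intermediate Wakimoto operators satisfy relation (R1): [ρ(H_i)_m, ρ(H_j)_p] = (α_i|α_j) · c₀ · m · δ_{m+p,0} · id, where (α_i|α_j) = (A_n)_{ij} and c₀ = γ² − (r+1). -/
open MvPolynomial

/-- The Cartan matrix of `sl(n+1, ℂ)` in 1-based indices. -/
noncomputable def cartanEntry (i j : ℕ) : ℂ :=
  if i = j then 2 else if i + 1 = j ∨ j + 1 = i then -1 else 0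

/-- The entries of the matrix `𝔅` (1-based indices). -/
noncomputable def Bentry (r : ℕ) (γ : ℂ) (i j : ℕ) : ℂ :=
  cartanEntry i j *
    (γ ^ 2 - (if r < i then 1 else 0) * (if r < j then 1 else 0) * ((r : ℂ) + 1)
      + ((r : ℂ) / 2) * (if i = r + 1 then 1 else 0) * (if j = r + 1 then 1 else 0))

/-- Index set for the variables `x_{ij,m}`, `1 ≤ i ≤ j ≤ n`, `m ∈ ℤ`. -/
abbrev XIdx (n : ℕ) : Type := {v : ℕ × ℕ // 1 ≤ v.1 ∧ v.1 ≤ v.2 ∧ v.2 ≤ n} × ℤ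

/-- Index set for the variables `y_{k,m}`, `1 ≤ k ≤ n` (encoded by `Fin n`,
`k ↦ k + 1`) and `m ≥ 1`. -/
abbrev YIdx (n : ℕ) : Type := Fin n × {m : ℕ // 1 ≤ m}

/-- The Fock space `F = ℂ[x_{ij,m}; y_{k,m}]`. -/
abbrev FSp (n : ℕ) : Type := MvPolynomial (XIdx n ⊕ YIdx n) ℂ

/-- The operator `a_{ij,m}`: it is `∂/∂x_{ij,m}` if `m ≥ 0` and `j ≤ r`, and
multiplication by `x_{ij,m}` otherwise (and junk `0` for invalid indices `i, j`,
which are never used).  Applied to any fixed polynomial, all the `∑ᶠ` sums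
appearing below have finite support, so they compute the intended operators. -/
noncomputable def aop (n r i j : ℕ) (m : ℤ) : FSp n → FSp n :=
  if h : 1 ≤ i ∧ i ≤ j ∧ j ≤ n then
    (if 0 ≤ m ∧ j ≤ r then fun q => pderiv (Sum.inl (⟨(i, j), h⟩, m)) q
     else fun q => X (Sum.inl (⟨(i, j), h⟩, m)) * q)
  else 0

/-- The operator `a*_{ij,m}`: multiplication by `x_{ij,−m}` if `m ≤ 0` and `j ≤ r`,
and `−∂/∂x_{ij,−m}` otherwise. -/
noncomputable def astarop (n r i j : ℕ) (m : ℤ) : FSp n → FSp n :=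
  if h : 1 ≤ i ∧ i ≤ j ∧ j ≤ n then
    (if m ≤ 0 ∧ j ≤ r then fun q => X (Sum.inl (⟨(i, j), h⟩, -m)) * q
     else fun q => -pderiv (Sum.inl (⟨(i, j), h⟩, -m)) q)
  else 0

/-- The polynomial `e_i·𝐲_m = Σ_{k=1}^n (e_i)_k y_{k,m}`. -/
noncomputable def yPoly (n : ℕ) (e : ℕ → ℕ → ℂ) (i : ℕ) (m : {m : ℕ // 1 ≤ m}) :
    FSp n :=
  ∑ k : Fin n, e i (k.1 + 1) • X (Sum.inr (k, m))

/-- The operator `b_{i,m}`:  `b_{i,0} = λ_i · id`; for `m > 0`, `b_{i,−m}` is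
multiplication by `e_i·𝐲_m` and `b_{i,m} = m Σ_k (e_i)_k ∂/∂y_{k,m}`. -/
noncomputable def bop (n : ℕ) (e : ℕ → ℕ → ℂ) (lam : ℕ → ℂ) (i : ℕ) (m : ℤ) :
    FSp n → FSp n :=
  if h : 0 < m then
    fun q => (m : ℂ) • ∑ k : Fin n,
      e i (k.1 + 1) • pderiv (Sum.inr (k, ⟨m.toNat, by omega⟩)) q
  else if h' : m = 0 then fun q => lam i • q
  else fun q => yPoly n e i ⟨(-m).toNat, by omega⟩ * q

/-- The normally ordered pair `:a_{ij,u} a*_{kl,v}:` : the annihilation operator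
(`a_{ij,u}` with `u ≥ 0`, `j ≤ r`) is moved to the right of the creation operator. -/
noncomputable def nAA (n r i j k l : ℕ) (u v : ℤ) : FSp n → FSp n :=
  if 0 ≤ u ∧ j ≤ r then fun q => astarop n r k l v (aop n r i j u q)
  else fun q => aop n r i j u (astarop n r k l v q)

/-- Mode `m` (coefficient of `z^{−m−1}`) of the normally ordered product
`:a_{ij}(z) a*_{kl}(z):`. -/
noncomputable def nAAmode (n r i j k l : ℕ) (m : ℤ) : FSp n → FSp n :=
  fun q => ∑ᶠ s : ℤ, nAA n r i j k l s (m - s) q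

/-- Normal ordering of the mode `a*_{ij,s}` against an operator `B`: an
annihilating `a*_{ij,s}` (i.e. `s > 0` and `j ≤ r`, or `j > r`) is moved to the
right of `B`. -/
noncomputable def nStar (n r i j : ℕ) (s : ℤ) (B : FSp n → FSp n) : FSp n → FSp n :=
  if (j ≤ r ∧ 0 < s) ∨ r < j then fun q => B (astarop n r i j s q)
  else fun q => astarop n r i j s (B q)

/-- The intermediate Wakimoto mode operator `ρ(H_i)_m`. -/
noncomputable def rhoH (n r : ℕ) (e : ℕ → ℕ → ℂ) (lam : ℕ → ℂ) (i : ℕ) (m : ℤ) :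
    FSp n → FSp n :=
  fun q => (2 : ℂ) • nAAmode n r i i i i m q
    + ∑ j ∈ Finset.Ico 1 i,
        (nAAmode n r j i j i m q - nAAmode n r j (i - 1) j (i - 1) m q)
    + ∑ j ∈ Finset.Icc (i + 1) n,
        (nAAmode n r i j i j m q - nAAmode n r (i + 1) j (i + 1) j m q)
    + bop n e lam i m q

/-- The intermediate Wakimoto mode operator `ρ(F_i)_m`. -/
noncomputable def rhoF (n r i : ℕ) (m : ℤ) : FSp n → FSp n :=
  fun q => aop n r i i m q
    + ∑ j ∈ Finset.Icc (i + 1) n,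
        ∑ᶠ s : ℤ, aop n r i j s (astarop n r (i + 1) j (m - s) q)

/-- The intermediate Wakimoto mode operator `ρ(E_i)_m`. -/
noncomputable def rhoE (n r : ℕ) (γ : ℂ) (e : ℕ → ℕ → ℂ) (lam : ℕ → ℂ) (i : ℕ)
    (m : ℤ) : FSp n → FSp n :=
  fun q =>
    (∑ᶠ s : ℤ, nStar n r i i s
        ((∑ k ∈ Finset.Ico 1 i, nAAmode n r k (i - 1) k (i - 1) (m - s))
          - ∑ k ∈ Finset.Icc 1 i, nAAmode n r k i k i (m - s)) q)
    + ∑ k ∈ Finset.Icc (i + 1) n,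
        ∑ᶠ s : ℤ, aop n r (i + 1) k s (astarop n r i k (m - s) q)
    - ∑ k ∈ Finset.Ico 1 i,
        ∑ᶠ s : ℤ, aop n r k (i - 1) s (astarop n r k i (m - s) q)
    - ∑ᶠ s : ℤ, astarop n r i i s (bop n e lam i (m - s) q)
    - ((if r < i then (r : ℂ) + 1 else (i : ℂ) + 1) - γ ^ 2) •
        ((-(m : ℂ)) • astarop n r i i m q)

/-- Commutator of two operators. -/
noncomputable def opComm (n : ℕ) (A B : FSp n → FSp n) : FSp n → FSp n :=
  fun q => A (B q) - B (A q)

attribute [local instance] LieRing.ofAssociativeRing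

/-- Positive roots `(k, l)`, `1 ≤ k ≤ l ≤ n`. -/
abbrev PosRoot (n : ℕ) : Type := {v : ℕ × ℕ // 1 ≤ v.1 ∧ v.1 ≤ v.2 ∧ v.2 ≤ n}

section LocallyFinite

variable {V : Type*} [AddCommGroup V] [Module ℂ V]

lemma lie_mul_right (t x y : Module.End ℂ V) : ⁅t, x * y⁆ = x * ⁅t, y⁆ + ⁅t, x⁆ * y := by
  simp only [LieRing.of_associative_ring_bracket]
  noncomm_ring

/-- The sum of a locally finite family of linear endomorphisms. -/
noncomputable def locFinSum (f : ℤ → Module.End ℂ V)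
    (hf : ∀ q, (fun s => f s q).HasFiniteSupport) : Module.End ℂ V where
  toFun q := ∑ᶠ s, f s q
  map_add' q q' := by
    simp only [map_add]
    exact finsum_add_distrib (hf q) (hf q')
  map_smul' c q := by
    simp only [map_smul, RingHom.id_apply]
    exact (smul_finsum' c (hf q)).symm

lemma locFinSum_apply (f : ℤ → Module.End ℂ V)
    (hf : ∀ q, (fun s => f s q).HasFiniteSupport) (q : V) :
    locFinSum f hf q = ∑ᶠ s, f s q := rfl

lemma lie_locFinSum_apply (T : Module.End ℂ V) (f : ℤ → Module.End ℂ V)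
    (hf : ∀ q, (fun s => f s q).HasFiniteSupport) (q : V) :
    ⁅T, locFinSum f hf⁆ q = ∑ᶠ s, ⁅T, f s⁆ q := by
  have h : (fun s => T (f s q)).HasFiniteSupport :=
    (hf q).subset fun s hs h0 => hs (by simp only at h0 ⊢; rw [h0, map_zero])
  simp only [LieRing.of_associative_ring_bracket, LinearMap.sub_apply, Module.End.mul_apply,
    locFinSum_apply]
  rw [map_finsum T (hf q), finsum_sub_distrib h (hf (T q))]

lemma lie_locFinSum_eq_of_single (T : Module.End ℂ V) (f : ℤ → Module.End ℂ V)
    (hf : ∀ q, (fun s => f s q).HasFiniteSupport) (s₀ : ℤ)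
    (h : ∀ s, s ≠ s₀ → ⁅T, f s⁆ = 0) : ⁅T, locFinSum f hf⁆ = ⁅T, f s₀⁆ := by
  refine LinearMap.ext fun q => ?_
  rw [lie_locFinSum_apply]
  exact finsum_eq_single _ s₀ fun s hs => by rw [h s hs, LinearMap.zero_apply]

end LocallyFinite

lemma hasFiniteSupport_step_sub (m : ℤ) :
    (fun s : ℤ => ((if 0 ≤ s then 1 else 0) - (if 0 ≤ s + m then 1 else 0) : ℂ)).HasFiniteSupport
      := by
  refine (Set.finite_Icc (-|m|) |m|).subset fun s hs => ?_
  by_contra h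
  refine hs ?_
  have h₁ := le_abs_self m
  have h₂ := neg_abs_le m
  rw [Set.mem_Icc, not_and_or] at h
  simp only
  split_ifs <;> first | (exfalso; omega) | simp

lemma finsum_step_sub (m : ℤ) :
    ∑ᶠ s : ℤ, ((if 0 ≤ s then 1 else 0) - (if 0 ≤ s + m then 1 else 0) : ℂ) = -m := by
  rcases le_total 0 m with hm | hm
  · rw [finsum_eq_sum_of_support_subset (s := Finset.Ico (-m) 0),
      Finset.sum_congr rfl (g := fun _ => (-1 : ℂ))]
    · lift m to ℕ using hm
      simp
    · intro s hs
      rw [Finset.mem_Ico] at hs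
      rw [if_neg (by omega), if_pos (by omega), zero_sub]
    · intro s hs
      simp only [Function.mem_support] at hs
      simp only [Finset.coe_Ico, Set.mem_Ico]
      by_contra h
      refine hs ?_
      split_ifs <;> first | (exfalso; omega) | simp
  · rw [finsum_eq_sum_of_support_subset (s := Finset.Ico 0 (-m)),
      Finset.sum_congr rfl (g := fun _ => (1 : ℂ))]
    · obtain ⟨k, rfl⟩ : ∃ k : ℕ, m = -k := ⟨m.natAbs, by omega⟩
      simp
    · intro s hs
      rw [Finset.mem_Ico] at hs
      rw [if_pos (by omega), if_neg (by omega), sub_zero]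
    · intro s hs
      simp only [Function.mem_support] at hs
      simp only [Finset.coe_Ico, Set.mem_Ico]
      by_contra h
      refine hs ?_
      split_ifs <;> first | (exfalso; omega) | simp

/-- A family of mutually commuting Heisenberg (`βγ`) systems `a v s`, `aStar v s` acting on `V`,
with a choice `pol v` of which of them are normally ordered with respect to the modes `s ≥ 0`, and
such that the modes of the normally ordered products `:a v aStar v:` are locally finite sums. -/
structure BetaGammaFamily (ι V : Type*) [AddCommGroup V] [Module ℂ V] where
  /-- The modes `a_{v,s}`. -/
  a : ι → ℤ → Module.End ℂ V
  /-- The modes `a*_{v,s}`. -/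
  aStar : ι → ℤ → Module.End ℂ V
  /-- The systems for which `a_{v,s}` with `s ≥ 0` is moved to the right. -/
  pol : ι → Prop
  a_comm : ∀ v w s t q, a v s (a w t q) = a w t (a v s q)
  aStar_comm : ∀ v w s t q, aStar v s (aStar w t q) = aStar w t (aStar v s q)
  a_aStar_comm : ∀ v w s t q, ¬(v = w ∧ s + t = 0) → a v s (aStar w t q) = aStar w t (a v s q)
  a_aStar_self : ∀ v s t q, s + t = 0 → a v s (aStar v t q) = aStar v t (a v s q) + q
  finite_pol : ∀ v m q, pol v → {s | 0 ≤ s ∧ aStar v (m - s) (a v s q) ≠ 0}.Finite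
  finite_not_pol : ∀ v m q,
    {s | ¬(0 ≤ s ∧ pol v) ∧ a v s (aStar v (m - s) q) ≠ 0}.Finite

namespace BetaGammaFamily

open scoped Classical

variable {ι V : Type*} [AddCommGroup V] [Module ℂ V] (G : BetaGammaFamily ι V)

lemma lie_a_a (v w : ι) (s t : ℤ) : ⁅G.a v s, G.a w t⁆ = 0 := by
  rw [LieRing.of_associative_ring_bracket, sub_eq_zero]
  exact LinearMap.ext (G.a_comm v w s t)

lemma lie_aStar_aStar (v w : ι) (s t : ℤ) : ⁅G.aStar v s, G.aStar w t⁆ = 0 := by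
  rw [LieRing.of_associative_ring_bracket, sub_eq_zero]
  exact LinearMap.ext (G.aStar_comm v w s t)

lemma lie_a_aStar (v w : ι) (s t : ℤ) :
    ⁅G.a v s, G.aStar w t⁆ = if v = w ∧ s + t = 0 then 1 else 0 := by
  rw [LieRing.of_associative_ring_bracket]
  split_ifs with h
  · obtain ⟨rfl, h⟩ := h
    rw [sub_eq_iff_eq_add']
    exact LinearMap.ext fun q => G.a_aStar_self v s t q h
  · rw [sub_eq_zero]
    exact LinearMap.ext fun q => G.a_aStar_comm v w s t q h

lemma lie_aStar_a (v w : ι) (s t : ℤ) :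
    ⁅G.aStar v s, G.a w t⁆ = if v = w ∧ s + t = 0 then -1 else 0 := by
  rw [← lie_skew, G.lie_a_aStar, eq_comm (a := w), add_comm t]
  split_ifs <;> simp

/-- The normally ordered pair `:a_{v,s} a*_{v,u}:` as a linear endomorphism. -/
noncomputable def nPair (v : ι) (s u : ℤ) : Module.End ℂ V :=
  if 0 ≤ s ∧ G.pol v then G.aStar v u * G.a v s else G.a v s * G.aStar v u

lemma a_mul_aStar (v : ι) (s u : ℤ) :
    G.a v s * G.aStar v u = G.nPair v s u +
      if (0 ≤ s ∧ G.pol v) ∧ s + u = 0 then 1 else 0 := by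
  have h := G.lie_a_aStar v v s u
  rw [LieRing.of_associative_ring_bracket, sub_eq_iff_eq_add] at h
  unfold nPair
  by_cases h₁ : 0 ≤ s ∧ G.pol v
  · rw [if_pos h₁, h, add_comm]
    simp [h₁]
  · simp [h₁]

lemma lie_nPair (T : Module.End ℂ V) (v : ι) (s u : ℤ) :
    ⁅T, G.nPair v s u⁆ = ⁅T, G.a v s * G.aStar v u⁆ := by
  have h1 : ⁅T, (1 : Module.End ℂ V)⁆ = 0 := by
    simp [LieRing.of_associative_ring_bracket]
  rw [G.a_mul_aStar, lie_add]
  split_ifs <;> simp [h1]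

lemma hasFiniteSupport_nPair (v : ι) (m : ℤ) (q : V) :
    (fun s => G.nPair v s (m - s) q).HasFiniteSupport := by
  by_cases hv : G.pol v
  · refine ((G.finite_pol v m q hv).union (G.finite_not_pol v m q)).subset fun s hs => ?_
    simp only [Function.mem_support, nPair] at hs
    by_cases h : 0 ≤ s ∧ G.pol v
    · rw [if_pos h] at hs
      exact Or.inl ⟨h.1, hs⟩
    · rw [if_neg h] at hs
      exact Or.inr ⟨h, hs⟩
  · refine (G.finite_not_pol v m q).subset fun s hs => ?_
    simp only [Function.mem_support, nPair] at hs
    have h : ¬(0 ≤ s ∧ G.pol v) := fun h => hv h.2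
    rw [if_neg h] at hs
    exact ⟨h, hs⟩

/-- Mode `m` of `:a_v(z) a*_v(z):` as a linear endomorphism. -/
noncomputable def current (v : ι) (m : ℤ) : Module.End ℂ V :=
  locFinSum (fun s => G.nPair v s (m - s)) (G.hasFiniteSupport_nPair v m)

lemma lie_current_of_commute (T : Module.End ℂ V) (v : ι)
    (h₁ : ∀ s, ⁅T, G.a v s⁆ = 0) (h₂ : ∀ s, ⁅T, G.aStar v s⁆ = 0) (m : ℤ) :
    ⁅T, G.current v m⁆ = 0 := by
  refine LinearMap.ext fun q => ?_
  rw [current, lie_locFinSum_apply]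
  simp [G.lie_nPair, lie_mul_right, h₁, h₂]

lemma lie_current_a (v : ι) (m t : ℤ) :
    ⁅G.current v m, G.a v t⁆ = -G.a v (t + m) := by
  have key (s : ℤ) : ⁅G.a v t, G.nPair v s (m - s)⁆
      = if s = t + m then G.a v (t + m) else 0 := by
    rw [G.lie_nPair, lie_mul_right, G.lie_a_a, zero_mul, add_zero, G.lie_a_aStar]
    by_cases h : s = t + m
    · subst h; simp
    · rw [if_neg h, if_neg (by omega), mul_zero]
  rw [← lie_skew, current, lie_locFinSum_eq_of_single _ _ _ (t + m), key, if_pos rfl]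
  intro s hs
  rw [key, if_neg hs]

lemma lie_current_aStar (v : ι) (m t : ℤ) :
    ⁅G.current v m, G.aStar v t⁆ = G.aStar v (t + m) := by
  have key (s : ℤ) : ⁅G.aStar v t, G.nPair v s (m - s)⁆
      = if s = -t then -G.aStar v (t + m) else 0 := by
    rw [G.lie_nPair, lie_mul_right, G.lie_aStar_aStar, mul_zero, zero_add, G.lie_aStar_a]
    by_cases h : s = -t
    · subst h; simp [add_comm]
    · rw [if_neg h, if_neg (by omega), zero_mul]
  rw [← lie_skew, current, lie_locFinSum_eq_of_single _ _ _ (-t), key, if_pos rfl, neg_neg]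
  intro s hs
  rw [key, if_neg hs]

lemma lie_current_current_of_ne {v w : ι} (h : v ≠ w) (m p : ℤ) :
    ⁅G.current v m, G.current w p⁆ = 0 := by
  apply G.lie_current_of_commute
  all_goals
    intro s
    rw [← lie_skew, neg_eq_zero]
    apply G.lie_current_of_commute
    all_goals intro t
  · exact G.lie_a_a _ _ _ _
  · rw [G.lie_a_aStar, if_neg fun h' => h h'.1.symm]
  · rw [G.lie_aStar_a, if_neg fun h' => h h'.1.symm]
  · exact G.lie_aStar_aStar _ _ _ _

lemma lie_current_nPair (v : ι) (m p s : ℤ) :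
    ⁅G.current v m, G.nPair v s (p - s)⁆ =
      G.nPair v s ((m + p) - s) - G.nPair v (s + m) ((m + p) - (s + m)) +
      ((if G.pol v ∧ m + p = 0 then 1 else 0 : ℂ) *
        ((if 0 ≤ s then 1 else 0) - (if 0 ≤ s + m then 1 else 0))) • 1 := by
  rw [G.lie_nPair, lie_mul_right, G.lie_current_a, G.lie_current_aStar, neg_mul,
    G.a_mul_aStar, G.a_mul_aStar, show p - s + m = m + p - s by ring,
    show m + p - (s + m) = p - s by ring]
  rw [show s + (m + p - s) = m + p by ring, show s + m + (p - s) = m + p by ring]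
  by_cases h : G.pol v <;> by_cases h' : m + p = 0 <;> by_cases hs : 0 ≤ s <;>
    by_cases hsm : 0 ≤ s + m <;> simp [h, h', hs, hsm] <;> abel

lemma lie_current_current_self (v : ι) (m p : ℤ) :
    ⁅G.current v m, G.current v p⁆ =
      (if G.pol v ∧ m + p = 0 then -(m : ℂ) else 0 : ℂ) • 1 := by
  refine LinearMap.ext fun q => ?_
  have h₁ := G.hasFiniteSupport_nPair v (m + p) q
  have h₂ : (fun s => G.nPair v (s + m) (m + p - (s + m)) q).HasFiniteSupport :=
    h₁.preimage (f := fun s : ℤ => s + m) fun a _ b _ h => by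
      simpa using h
  have h₁₂ : (fun s => G.nPair v s (m + p - s) q -
      G.nPair v (s + m) (m + p - (s + m)) q).HasFiniteSupport := h₁.sub h₂
  have h₃ : (fun s : ℤ => (((if G.pol v ∧ m + p = 0 then 1 else 0 : ℂ) *
      ((if 0 ≤ s then 1 else 0) - (if 0 ≤ s + m then 1 else 0))) •
        (1 : Module.End ℂ V)) q).HasFiniteSupport := by
    refine (hasFiniteSupport_step_sub m).subset fun s hs h0 => hs ?_
    simp only at h0 ⊢
    rw [h0, mul_zero, zero_smul, LinearMap.zero_apply]
  have hshift : ∑ᶠ s, G.nPair v (s + m) (m + p - (s + m)) q =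
      ∑ᶠ s, G.nPair v s (m + p - s) q :=
    finsum_comp_equiv (Equiv.addRight m) (f := fun s => G.nPair v s (m + p - s) q)
  refine (lie_locFinSum_apply _ _ (G.hasFiniteSupport_nPair v p) q).trans ?_
  simp only [G.lie_current_nPair, LinearMap.add_apply, LinearMap.sub_apply]
  rw [finsum_add_distrib h₁₂ h₃, finsum_sub_distrib h₁ h₂, hshift, sub_self, zero_add]
  simp only [LinearMap.smul_apply, Module.End.one_apply]
  rw [← finsum_smul, ← mul_finsum, finsum_step_sub]
  split_ifs <;> simp

lemma lie_current (v w : ι) (m p : ℤ) :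
    ⁅G.current v m, G.current w p⁆ =
      ((if v = w ∧ G.pol v then 1 else 0) * (if m + p = 0 then -(m : ℂ) else 0) : ℂ) • 1 := by
  by_cases h : v = w
  · subst h
    rw [lie_current_current_self]
    by_cases hv : G.pol v <;> simp [hv]
  · simp [lie_current_current_of_ne G h, h]

end BetaGammaFamily

section Cartan

variable {n : ℕ} {V : Type*} [AddCommGroup V] [Module ℂ V]

lemma sum_sum_ite_eq_zero {s t : Finset ℕ} {P : ℕ → ℕ → Prop} [∀ x y, Decidable (P x y)]
    (h : ∀ x ∈ s, ∀ y ∈ t, ¬P x y) : ∑ x ∈ s, ∑ y ∈ t, (if P x y then 1 else 0 : ℂ) = 0 :=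
  Finset.sum_eq_zero fun x hx => Finset.sum_eq_zero fun y hy => if_neg (h x hx y hy)

lemma sum_sum_ite_eq_one {s t : Finset ℕ} {P : ℕ → ℕ → Prop} [∀ x y, Decidable (P x y)]
    {x₀ y₀ : ℕ} (hx₀ : x₀ ∈ s) (hy₀ : y₀ ∈ t)
    (h : ∀ x ∈ s, ∀ y ∈ t, P x y ↔ x = x₀ ∧ y = y₀) :
    ∑ x ∈ s, ∑ y ∈ t, (if P x y then 1 else 0 : ℂ) = 1 := by
  rw [Finset.sum_eq_single_of_mem x₀ hx₀, Finset.sum_eq_single_of_mem y₀ hy₀]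
  · rw [if_pos ((h x₀ hx₀ y₀ hy₀).2 ⟨rfl, rfl⟩)]
  · exact fun y hy hne => if_neg fun hP => hne ((h x₀ hx₀ y hy).1 hP).2
  · exact fun x hx hne => Finset.sum_eq_zero fun y hy =>
      if_neg fun hP => hne ((h x hx y hy).1 hP).1

lemma sum_sum_ite_diag {s u : Finset ℕ} {P : ℕ → ℕ → Prop} [∀ x y, Decidable (P x y)]
    (hu : u ⊆ s) (h : ∀ x ∈ s, ∀ y ∈ s, P x y ↔ x = y ∧ x ∈ u) :
    ∑ x ∈ s, ∑ y ∈ s, (if P x y then 1 else 0 : ℂ) = u.card := by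
  have hrow (x : ℕ) (hx : x ∈ s) :
      ∑ y ∈ s, (if P x y then 1 else 0 : ℂ) = if x ∈ u then 1 else 0 := by
    rw [Finset.sum_eq_single_of_mem x hx]
    · simp [h x hx x hx]
    · exact fun y hy hne => if_neg fun hP => hne ((h x hx y hy).1 hP).1.symm
  rw [Finset.sum_congr rfl hrow, Finset.sum_ite_mem, Finset.inter_eq_right.2 hu]
  simp

/-- The current attached to the root `(k, l)`, and `0` if `(k, l)` is not a positive root. -/
noncomputable def rootCurrent (G : BetaGammaFamily (PosRoot n) V) (k l : ℕ) (m : ℤ) :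
    Module.End ℂ V :=
  if h : 1 ≤ k ∧ k ≤ l ∧ l ≤ n then G.current ⟨(k, l), h⟩ m else 0

/-- The sum of the currents of the positive roots weighted by their pairing with the `a`-th
coordinate functional. -/
noncomputable def coordCurrent (G : BetaGammaFamily (PosRoot n) V) (a : ℕ) (m : ℤ) :
    Module.End ℂ V :=
  ∑ l ∈ Finset.Icc a n, rootCurrent G a l m - ∑ k ∈ Finset.Ico 1 a, rootCurrent G k (a - 1) m

variable {r : ℕ} {G : BetaGammaFamily (PosRoot n) V}

lemma lie_rootCurrent (hG : ∀ v, G.pol v ↔ v.1.2 ≤ r) {k l k' l' : ℕ}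
    (h : 1 ≤ k ∧ k ≤ l ∧ l ≤ n) (h' : 1 ≤ k' ∧ k' ≤ l' ∧ l' ≤ n) (m p : ℤ) :
    ⁅rootCurrent G k l m, rootCurrent G k' l' p⁆ =
      (if k = k' ∧ l = l' ∧ l ≤ r then 1 else 0 : ℂ) •
        ((if m + p = 0 then -(m : ℂ) else 0 : ℂ) • (1 : Module.End ℂ V)) := by
  rw [rootCurrent, rootCurrent, dif_pos h, dif_pos h', G.lie_current, mul_smul]
  simp only [hG, Subtype.mk.injEq, Prod.mk.injEq, and_assoc]

/-- The level pairing of two coordinate currents. -/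
noncomputable def coordLevel (r a b : ℕ) : ℂ :=
  if a ≤ r + 1 ∧ b ≤ r + 1 then if a = b then r else -1 else 0

lemma lie_coordCurrent (hr : r ≤ n) (hG : ∀ v, G.pol v ↔ v.1.2 ≤ r) {a b : ℕ}
    (ha : 1 ≤ a) (ha' : a ≤ n + 1) (hb : 1 ≤ b) (hb' : b ≤ n + 1) (m p : ℤ) :
    ⁅coordCurrent G a m, coordCurrent G b p⁆ =
      coordLevel r a b • ((if m + p = 0 then -(m : ℂ) else 0 : ℂ) • (1 : Module.End ℂ V)) := by
  have expand (s t : Finset ℕ) (f g f' g' : ℕ → ℕ)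
      (hs : ∀ x ∈ s, 1 ≤ f x ∧ f x ≤ g x ∧ g x ≤ n)
      (ht : ∀ x ∈ t, 1 ≤ f' x ∧ f' x ≤ g' x ∧ g' x ≤ n) :
      ⁅∑ x ∈ s, rootCurrent G (f x) (g x) m, ∑ y ∈ t, rootCurrent G (f' y) (g' y) p⁆ =
        (∑ x ∈ s, ∑ y ∈ t, (if f x = f' y ∧ g x = g' y ∧ g x ≤ r then 1 else 0 : ℂ)) •
          ((if m + p = 0 then -(m : ℂ) else 0 : ℂ) • (1 : Module.End ℂ V)) := by
    simp only [sum_lie, Finset.sum_smul]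
    simp only [lie_sum]
    refine Finset.sum_congr rfl fun x hx => Finset.sum_congr rfl fun y hy => ?_
    exact lie_rootCurrent hG (hs x hx) (ht y hy) m p
  have hrow (a : ℕ) (ha : 1 ≤ a) : ∀ l ∈ Finset.Icc a n, 1 ≤ a ∧ a ≤ l ∧ l ≤ n := by
    simp only [Finset.mem_Icc]; omega
  have hcol (a : ℕ) (ha' : a ≤ n + 1) :
      ∀ k ∈ Finset.Ico 1 a, 1 ≤ k ∧ k ≤ a - 1 ∧ a - 1 ≤ n := by
    simp only [Finset.mem_Ico]; omega
  simp only [coordCurrent, sub_lie, lie_sub]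
  rw [expand _ _ (fun _ => a) (fun l => l) (fun _ => b) (fun l => l) (hrow a ha) (hrow b hb),
    expand _ _ (fun _ => a) (fun l => l) (fun k => k) (fun _ => b - 1) (hrow a ha) (hcol b hb'),
    expand _ _ (fun k => k) (fun _ => a - 1) (fun _ => b) (fun l => l) (hcol a ha') (hrow b hb),
    expand _ _ (fun k => k) (fun _ => a - 1) (fun k => k) (fun _ => b - 1)
      (hcol a ha') (hcol b hb')]
  simp only [← sub_smul]
  congr 1
  rcases lt_trichotomy a b with h | rfl | h
  · rw [sum_sum_ite_eq_zero (s := Finset.Icc a n) (t := Finset.Icc b n),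
      sum_sum_ite_eq_zero (s := Finset.Ico 1 a) (t := Finset.Icc b n),
      sum_sum_ite_eq_zero (s := Finset.Ico 1 a) (t := Finset.Ico 1 b)]
    · by_cases hbr : b ≤ r + 1
      · rw [sum_sum_ite_eq_one (x₀ := b - 1) (y₀ := a), coordLevel, if_pos (by omega),
          if_neg (by omega)]
        · ring
        all_goals simp only [Finset.mem_Icc, Finset.mem_Ico]; omega
      · rw [sum_sum_ite_eq_zero, coordLevel, if_neg (by omega)]
        · ring
        simp only [Finset.mem_Icc, Finset.mem_Ico]; omega
    all_goals simp only [Finset.mem_Icc, Finset.mem_Ico]; omega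
  · rw [sum_sum_ite_eq_zero (s := Finset.Icc a n) (t := Finset.Ico 1 a),
      sum_sum_ite_eq_zero (s := Finset.Ico 1 a) (t := Finset.Icc a n)]
    · by_cases har : a ≤ r + 1
      · rw [sum_sum_ite_diag (s := Finset.Icc a n) (u := Finset.Icc a r),
          sum_sum_ite_diag (s := Finset.Ico 1 a) (u := Finset.Ico 1 a), coordLevel,
          if_pos (by omega), if_pos rfl, Nat.card_Icc, Nat.card_Ico, Nat.cast_sub har,
          Nat.cast_sub ha]
        · push_cast; ring
        · exact subset_rfl
        · simp only [Finset.mem_Ico, true_and]; grind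
        · exact Finset.Icc_subset_Icc_right hr
        · simp only [Finset.mem_Icc, true_and]; grind
      · rw [sum_sum_ite_eq_zero, sum_sum_ite_eq_zero, coordLevel, if_neg (by omega)]
        · ring
        all_goals simp only [Finset.mem_Icc, Finset.mem_Ico]; omega
    all_goals simp only [Finset.mem_Icc, Finset.mem_Ico]; omega
  · rw [sum_sum_ite_eq_zero (s := Finset.Icc a n) (t := Finset.Icc b n),
      sum_sum_ite_eq_zero (s := Finset.Icc a n) (t := Finset.Ico 1 b),
      sum_sum_ite_eq_zero (s := Finset.Ico 1 a) (t := Finset.Ico 1 b)]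
    · by_cases har : a ≤ r + 1
      · rw [sum_sum_ite_eq_one (x₀ := b) (y₀ := a - 1), coordLevel, if_pos (by omega),
          if_neg (by omega)]
        · ring
        all_goals simp only [Finset.mem_Icc, Finset.mem_Ico]; omega
      · rw [sum_sum_ite_eq_zero, coordLevel, if_neg (by omega)]
        · ring
        simp only [Finset.mem_Icc, Finset.mem_Ico]; omega
    all_goals simp only [Finset.mem_Icc, Finset.mem_Ico]; omega

lemma Bentry_sub_coordLevel (γ : ℂ) {i j : ℕ} (hi : 1 ≤ i) (hj : 1 ≤ j) :
    Bentry r γ i j - (coordLevel r i j - coordLevel r (i + 1) j -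
      (coordLevel r i (j + 1) - coordLevel r (i + 1) (j + 1))) =
      cartanEntry i j * (γ ^ 2 - ((r : ℂ) + 1)) := by
  unfold Bentry coordLevel cartanEntry
  by_cases h₁ : i = j
  · subst h₁
    rcases lt_trichotomy i (r + 1) with h | h | h
    · simp [h.le, h.ne, show ¬r < i by omega, show i ≤ r by omega]
      ring
    · subst h
      simp
      ring
    · simp [h.ne', show r < i by omega, show ¬i ≤ r + 1 by omega, show ¬i ≤ r by omega]
  · by_cases h₂ : i + 1 = j
    · subst h₂
      simp only [h₁, if_false, if_true, true_or, show i ≠ i + 1 + 1 by omega,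
        show i + 1 ≠ i + 1 + 1 by omega]
      split_ifs <;> first | (exfalso; omega) | ring
    · by_cases h₃ : j + 1 = i
      · subst h₃
        simp only [h₁, if_false, if_true, or_true, show j + 1 + 1 ≠ j by omega,
          show j + 1 + 1 ≠ j + 1 by omega]
        split_ifs <;> first | (exfalso; omega) | ring
      · simp only [h₁, h₂, h₃, Ne.symm h₃, if_false, or_self, zero_mul,
          show i + 1 ≠ j + 1 by omega]
        split_ifs <;> first | (exfalso; omega) | ring

lemma lie_coordCurrent_of_commute (T : Module.End ℂ V)
    (h₁ : ∀ v s, ⁅T, G.a v s⁆ = 0) (h₂ : ∀ v s, ⁅T, G.aStar v s⁆ = 0) (a : ℕ) (m : ℤ) :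
    ⁅T, coordCurrent G a m⁆ = 0 := by
  have h (k l : ℕ) : ⁅T, rootCurrent G k l m⁆ = 0 := by
    unfold rootCurrent
    split_ifs with hkl
    · exact G.lie_current_of_commute T _ (h₁ _) (h₂ _) m
    · exact lie_zero T
  simp [coordCurrent, lie_sub, lie_sum, h]

lemma coordCurrent_sub_coordCurrent_succ {i : ℕ} (hi : 1 ≤ i) (hi' : i ≤ n) (m : ℤ) :
    coordCurrent G i m - coordCurrent G (i + 1) m =
      (2 : ℂ) • rootCurrent G i i m
        + ∑ j ∈ Finset.Ico 1 i, (rootCurrent G j i m - rootCurrent G j (i - 1) m)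
        + ∑ j ∈ Finset.Icc (i + 1) n, (rootCurrent G i j m - rootCurrent G (i + 1) j m) := by
  rw [coordCurrent, coordCurrent, ← Finset.add_sum_Ioc_eq_sum_Icc hi',
    Finset.sum_Ico_succ_top hi, Nat.add_sub_cancel, Finset.sum_sub_distrib,
    Finset.sum_sub_distrib, two_smul]
  have : Finset.Ioc i n = Finset.Icc (i + 1) n := by
    ext; simp only [Finset.mem_Ioc, Finset.mem_Icc]; omega
  rw [this]
  abel

/-- The Cartan currents attached to a free field realization: the sum of the root currents weighted
by their pairing with the `i`-th simple root, plus a Heisenberg current `B`. -/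
noncomputable def cartanCurrent (G : BetaGammaFamily (PosRoot n) V)
    (B : ℕ → ℤ → Module.End ℂ V) (i : ℕ) (m : ℤ) : Module.End ℂ V :=
  coordCurrent G i m - coordCurrent G (i + 1) m + B i m

theorem lie_cartanCurrent (hr : r ≤ n) (hG : ∀ v, G.pol v ↔ v.1.2 ≤ r) (γ : ℂ)
    {B : ℕ → ℤ → Module.End ℂ V}
    (hBa : ∀ i m v s, ⁅B i m, G.a v s⁆ = 0) (hBs : ∀ i m v s, ⁅B i m, G.aStar v s⁆ = 0)
    {i j : ℕ} (hi : 1 ≤ i) (hi' : i ≤ n) (hj : 1 ≤ j) (hj' : j ≤ n) (m p : ℤ)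
    (hB : ⁅B i m, B j p⁆ = ((if m + p = 0 then m else 0 : ℂ) * Bentry r γ i j) • 1) :
    ⁅cartanCurrent G B i m, cartanCurrent G B j p⁆ =
      (cartanEntry i j * (γ ^ 2 - ((r : ℂ) + 1)) * (m : ℂ) * (if m + p = 0 then 1 else 0)) • 1 := by
  have hc (i : ℕ) (m : ℤ) (a : ℕ) (p : ℤ) : ⁅B i m, coordCurrent G a p⁆ = 0 :=
    lie_coordCurrent_of_commute _ (hBa i m) (hBs i m) a p
  have hc' (i : ℕ) (m : ℤ) (a : ℕ) (p : ℤ) : ⁅coordCurrent G a p, B i m⁆ = 0 := by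
    rw [← lie_skew, hc, neg_zero]
  simp only [cartanCurrent, add_lie, sub_lie, lie_add, lie_sub, hc, hc', hB]
  rw [lie_coordCurrent hr hG hi (by omega) hj (by omega),
    lie_coordCurrent hr hG (by omega) (by omega) hj (by omega),
    lie_coordCurrent hr hG hi (by omega) (by omega) (by omega),
    lie_coordCurrent hr hG (by omega) (by omega) (by omega) (by omega),
    ← Bentry_sub_coordLevel γ hi hj]
  split_ifs
  · module
  · simp

end Cartan

section Fock

lemma derivation_comm_of_const {σ : Type*}
    (D₁ D₂ : Derivation ℂ (MvPolynomial σ ℂ) (MvPolynomial σ ℂ))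
    (h₁ : ∀ k, ∃ c, D₁ (X k) = C c) (h₂ : ∀ k, ∃ c, D₂ (X k) = C c) (q : MvPolynomial σ ℂ) :
    D₁ (D₂ q) = D₂ (D₁ q) := by
  have h : ⁅D₁, D₂⁆ = 0 := by
    refine MvPolynomial.derivation_ext fun k => ?_
    obtain ⟨c₁, hc₁⟩ := h₁ k
    obtain ⟨c₂, hc₂⟩ := h₂ k
    rw [Derivation.commutator_apply, hc₁, hc₂]
    simp
  have := congrArg (fun D => D q) h
  simpa [Derivation.commutator_apply, sub_eq_zero] using this

lemma derivation_mul_of_eq_zero {σ : Type*}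
    (D : Derivation ℂ (MvPolynomial σ ℂ) (MvPolynomial σ ℂ)) {f : MvPolynomial σ ℂ}
    (hf : D f = 0) (q : MvPolynomial σ ℂ) : D (f * q) = f * D q := by
  simp [Derivation.leibniz, hf]

lemma exists_pderiv_X_eq_C {σ : Type*} (i k : σ) :
    ∃ c : ℂ, pderiv i (X k : MvPolynomial σ ℂ) = C c := by
  classical
  rw [pderiv_X, Pi.single_apply]
  split_ifs
  · exact ⟨1, by simp⟩
  · exact ⟨0, by simp⟩

lemma pderiv_pderiv_comm {σ : Type*} (i j : σ) (q : MvPolynomial σ ℂ) :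
    pderiv i (pderiv j q) = pderiv j (pderiv i q) :=
  derivation_comm_of_const _ _ (exists_pderiv_X_eq_C i) (exists_pderiv_X_eq_C j) q

lemma finite_pderiv_ne_zero {σ : Type*} (q : MvPolynomial σ ℂ) :
    {i : σ | pderiv i q ≠ 0}.Finite :=
  q.vars.finite_toSet.subset fun _ hi => by
    by_contra h
    exact hi (pderiv_eq_zero_of_notMem_vars h)

variable {n : ℕ} (r : ℕ)

variable {r} in
lemma aop_of_pol {v : PosRoot n} {s : ℤ} (h : 0 ≤ s ∧ v.1.2 ≤ r) (q : FSp n) :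
    aop n r v.1.1 v.1.2 s q = pderiv (Sum.inl (v, s)) q := by
  rw [aop, dif_pos v.2, if_pos h]

variable {r} in
lemma aop_of_not_pol {v : PosRoot n} {s : ℤ} (h : ¬(0 ≤ s ∧ v.1.2 ≤ r)) (q : FSp n) :
    aop n r v.1.1 v.1.2 s q = X (Sum.inl (v, s)) * q := by
  rw [aop, dif_pos v.2, if_neg h]

variable {r} in
lemma astarop_of_pol {v : PosRoot n} {s : ℤ} (h : s ≤ 0 ∧ v.1.2 ≤ r) (q : FSp n) :
    astarop n r v.1.1 v.1.2 s q = X (Sum.inl (v, -s)) * q := by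
  rw [astarop, dif_pos v.2, if_pos h]

variable {r} in
lemma astarop_of_not_pol {v : PosRoot n} {s : ℤ} (h : ¬(s ≤ 0 ∧ v.1.2 ≤ r)) (q : FSp n) :
    astarop n r v.1.1 v.1.2 s q = -pderiv (Sum.inl (v, -s)) q := by
  rw [astarop, dif_pos v.2, if_neg h]

/-- The operator `a_{v,s}` as a linear endomorphism. -/
noncomputable def aEnd (v : PosRoot n) (s : ℤ) : Module.End ℂ (FSp n) where
  toFun := aop n r v.1.1 v.1.2 s
  map_add' p q := by
    by_cases h : 0 ≤ s ∧ v.1.2 ≤ r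
    · simp only [aop_of_pol h, map_add]
    · simp only [aop_of_not_pol h, mul_add]
  map_smul' c q := by
    by_cases h : 0 ≤ s ∧ v.1.2 ≤ r
    · simp only [aop_of_pol h, Derivation.map_smul, RingHom.id_apply]
    · simp only [aop_of_not_pol h, mul_smul_comm, RingHom.id_apply]

/-- The operator `a*_{v,s}` as a linear endomorphism. -/
noncomputable def aStarEnd (v : PosRoot n) (s : ℤ) : Module.End ℂ (FSp n) where
  toFun := astarop n r v.1.1 v.1.2 s
  map_add' p q := by
    by_cases h : s ≤ 0 ∧ v.1.2 ≤ r
    · simp only [astarop_of_pol h, mul_add]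
    · simp only [astarop_of_not_pol h, map_add, neg_add]
  map_smul' c q := by
    by_cases h : s ≤ 0 ∧ v.1.2 ≤ r
    · simp only [astarop_of_pol h, mul_smul_comm, RingHom.id_apply]
    · simp only [astarop_of_not_pol h, Derivation.map_smul, RingHom.id_apply, smul_neg]

lemma aop_comm (v w : PosRoot n) (s t : ℤ) (q : FSp n) :
    aop n r v.1.1 v.1.2 s (aop n r w.1.1 w.1.2 t q) =
      aop n r w.1.1 w.1.2 t (aop n r v.1.1 v.1.2 s q) := by
  by_cases h₁ : 0 ≤ s ∧ v.1.2 ≤ r <;> by_cases h₂ : 0 ≤ t ∧ w.1.2 ≤ r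
  · simp only [aop_of_pol h₁, aop_of_pol h₂]
    exact pderiv_pderiv_comm _ _ _
  · simp only [aop_of_pol h₁, aop_of_not_pol h₂]
    refine derivation_mul_of_eq_zero _ (pderiv_X_of_ne ?_) q
    simp only [ne_eq, Sum.inl.injEq, Prod.mk.injEq]
    rintro ⟨rfl, rfl⟩
    exact h₂ h₁
  · simp only [aop_of_not_pol h₁, aop_of_pol h₂]
    refine (derivation_mul_of_eq_zero _ (pderiv_X_of_ne ?_) q).symm
    simp only [ne_eq, Sum.inl.injEq, Prod.mk.injEq]
    rintro ⟨rfl, rfl⟩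
    exact h₁ h₂
  · simp only [aop_of_not_pol h₁, aop_of_not_pol h₂]
    exact mul_left_comm _ _ _

lemma astarop_comm (v w : PosRoot n) (s t : ℤ) (q : FSp n) :
    astarop n r v.1.1 v.1.2 s (astarop n r w.1.1 w.1.2 t q) =
      astarop n r w.1.1 w.1.2 t (astarop n r v.1.1 v.1.2 s q) := by
  by_cases h₁ : s ≤ 0 ∧ v.1.2 ≤ r <;> by_cases h₂ : t ≤ 0 ∧ w.1.2 ≤ r
  · simp only [astarop_of_pol h₁, astarop_of_pol h₂]
    exact mul_left_comm _ _ _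
  · simp only [astarop_of_pol h₁, astarop_of_not_pol h₂]
    rw [derivation_mul_of_eq_zero _ (pderiv_X_of_ne ?_) q, mul_neg]
    simp only [ne_eq, Sum.inl.injEq, Prod.mk.injEq, neg_inj]
    rintro ⟨rfl, rfl⟩
    exact h₂ h₁
  · simp only [astarop_of_not_pol h₁, astarop_of_pol h₂]
    rw [derivation_mul_of_eq_zero _ (pderiv_X_of_ne ?_) q, mul_neg]
    simp only [ne_eq, Sum.inl.injEq, Prod.mk.injEq, neg_inj]
    rintro ⟨rfl, rfl⟩
    exact h₁ h₂
  · simp only [astarop_of_not_pol h₁, astarop_of_not_pol h₂, map_neg]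
    rw [pderiv_pderiv_comm]

lemma aop_astarop_comm (v w : PosRoot n) (s t : ℤ) (q : FSp n) (h : ¬(v = w ∧ s + t = 0)) :
    aop n r v.1.1 v.1.2 s (astarop n r w.1.1 w.1.2 t q) =
      astarop n r w.1.1 w.1.2 t (aop n r v.1.1 v.1.2 s q) := by
  have hne : (Sum.inl (w, -t) : XIdx n ⊕ YIdx n) ≠ Sum.inl (v, s) := by
    simp only [ne_eq, Sum.inl.injEq, Prod.mk.injEq]
    rintro ⟨rfl, rfl⟩
    exact h ⟨rfl, by omega⟩
  by_cases h₁ : 0 ≤ s ∧ v.1.2 ≤ r <;> by_cases h₂ : t ≤ 0 ∧ w.1.2 ≤ r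
  · simp only [aop_of_pol h₁, astarop_of_pol h₂]
    exact derivation_mul_of_eq_zero _ (pderiv_X_of_ne hne) q
  · simp only [aop_of_pol h₁, astarop_of_not_pol h₂, map_neg]
    rw [pderiv_pderiv_comm]
  · simp only [aop_of_not_pol h₁, astarop_of_pol h₂]
    exact mul_left_comm _ _ _
  · simp only [aop_of_not_pol h₁, astarop_of_not_pol h₂]
    rw [derivation_mul_of_eq_zero _ (pderiv_X_of_ne hne.symm) q, mul_neg]

lemma aop_astarop_self (v : PosRoot n) (s t : ℤ) (q : FSp n) (h : s + t = 0) :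
    aop n r v.1.1 v.1.2 s (astarop n r v.1.1 v.1.2 t q) =
      astarop n r v.1.1 v.1.2 t (aop n r v.1.1 v.1.2 s q) + q := by
  obtain rfl : t = -s := by omega
  by_cases h₁ : 0 ≤ s ∧ v.1.2 ≤ r
  · have h₂ : -s ≤ 0 ∧ v.1.2 ≤ r := ⟨by omega, h₁.2⟩
    simp only [aop_of_pol h₁, astarop_of_pol h₂, neg_neg, pderiv_mul, pderiv_X_self]
    ring
  · have h₂ : ¬(-s ≤ 0 ∧ v.1.2 ≤ r) := fun h₂ => h₁ ⟨by omega, h₂.2⟩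
    simp only [aop_of_not_pol h₁, astarop_of_not_pol h₂, neg_neg, pderiv_mul, pderiv_X_self]
    ring

lemma finite_pderiv_inl_ne_zero (v : PosRoot n) (q : FSp n) :
    {t : ℤ | pderiv (Sum.inl (v, t)) q ≠ 0}.Finite :=
  (finite_pderiv_ne_zero q).preimage
    (f := fun t : ℤ => (Sum.inl (v, t) : XIdx n ⊕ YIdx n)) fun a _ b _ h => by simpa using h

variable (n) in
/-- The `βγ` systems acting on the Fock space. -/
noncomputable def fockBetaGamma : BetaGammaFamily (PosRoot n) (FSp n) where
  a := aEnd r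
  aStar := aStarEnd r
  pol v := v.1.2 ≤ r
  a_comm := aop_comm r
  aStar_comm := astarop_comm r
  a_aStar_comm := aop_astarop_comm r
  a_aStar_self := aop_astarop_self r
  finite_pol v m q hv := by
    refine (finite_pderiv_inl_ne_zero v q).subset fun s hs h0 => hs.2 ?_
    have h : aEnd r v s q = 0 := (aop_of_pol ⟨hs.1, hv⟩ q).trans h0
    rw [h, map_zero]
  finite_not_pol v m q := by
    have h₂ : {s : ℤ | pderiv (Sum.inl (v, -(m - s))) q ≠ 0}.Finite :=
      (finite_pderiv_inl_ne_zero v q).preimage (f := fun s : ℤ => -(m - s))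
        fun a _ b _ h => by simp only at h; omega
    refine (h₂.union (Set.finite_Ico m 0)).subset fun s hs => ?_
    by_contra hn
    simp only [Set.mem_union, Set.mem_ofPred_eq, not_or, not_not, Set.mem_Ico, not_and,
      not_lt] at hn
    refine hs.2 ?_
    have h : aStarEnd r v (m - s) q = 0 := by
      refine (astarop_of_not_pol (fun h' => hs.1 ⟨hn.2 (by omega), h'.2⟩) q).trans ?_
      rw [hn.1, neg_zero]
    rw [h, map_zero]

/-- The derivation `Σ_k (e_i)_k ∂/∂y_{k,t}`. -/
noncomputable def yDer (e : ℕ → ℕ → ℂ) (i : ℕ) (t : {m : ℕ // 1 ≤ m}) :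
    Derivation ℂ (FSp n) (FSp n) :=
  ∑ k : Fin n, e i (k.1 + 1) • pderiv (Sum.inr (k, t))

lemma yDer_apply (e : ℕ → ℕ → ℂ) (i : ℕ) (t : {m : ℕ // 1 ≤ m}) (q : FSp n) :
    yDer e i t q = ∑ k : Fin n, e i (k.1 + 1) • pderiv (Sum.inr (k, t)) q := by
  rw [yDer, ← Derivation.coeFnAddMonoidHom_apply, map_sum, Finset.sum_apply]
  rfl

lemma exists_yDer_X_eq_C (e : ℕ → ℕ → ℂ) (i : ℕ) (t : {m : ℕ // 1 ≤ m}) (k : XIdx n ⊕ YIdx n) :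
    ∃ c : ℂ, yDer e i t (X k : FSp n) = C c := by
  choose c hc using fun l : Fin n => exists_pderiv_X_eq_C (Sum.inr (l, t) : XIdx n ⊕ YIdx n) k
  refine ⟨∑ l : Fin n, e i (l.1 + 1) * c l, ?_⟩
  simp only [yDer_apply, hc, map_sum, C_mul, smul_eq_C_mul]

lemma yDer_X_inl (e : ℕ → ℕ → ℂ) (i : ℕ) (t : {m : ℕ // 1 ≤ m}) (v : XIdx n) :
    yDer e i t (X (Sum.inl v) : FSp n) = 0 := by
  rw [yDer_apply]
  exact Finset.sum_eq_zero fun k _ => by rw [pderiv_X_of_ne (by simp), smul_zero]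

lemma pderiv_inl_yPoly (e : ℕ → ℕ → ℂ) (i : ℕ) (t : {m : ℕ // 1 ≤ m}) (v : XIdx n) :
    pderiv (Sum.inl v) (yPoly n e i t) = 0 := by
  rw [yPoly, map_sum]
  exact Finset.sum_eq_zero fun k _ => by
    rw [Derivation.map_smul, pderiv_X_of_ne (by simp), smul_zero]

lemma yDer_yPoly (e : ℕ → ℕ → ℂ) (i j : ℕ) (t u : {m : ℕ // 1 ≤ m}) :
    yDer e i t (yPoly n e j u) =
      C (if t = u then ∑ k : Fin n, e i (k.1 + 1) * e j (k.1 + 1) else 0) := by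
  classical
  rw [yDer_apply]
  by_cases h : t = u
  · subst h
    rw [if_pos rfl, map_sum]
    refine Finset.sum_congr rfl fun k _ => ?_
    rw [yPoly, map_sum, Finset.sum_eq_single k]
    · rw [Derivation.map_smul, pderiv_X_self, smul_eq_C_mul, smul_eq_C_mul, mul_one, C_mul]
    · intro l _ hl
      rw [Derivation.map_smul, pderiv_X_of_ne (by simpa using hl), smul_zero]
    · simp
  · rw [if_neg h, C_0]
    refine Finset.sum_eq_zero fun k _ => ?_
    rw [yPoly, map_sum, Finset.sum_eq_zero, smul_zero]
    intro l _
    rw [Derivation.map_smul, pderiv_X_of_ne, smul_zero]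
    simp only [ne_eq, Sum.inr.injEq, Prod.mk.injEq, not_and]
    exact fun _ h' => h h'.symm

lemma yDer_comm (e : ℕ → ℕ → ℂ) (i j : ℕ) (t u : {m : ℕ // 1 ≤ m}) (q : FSp n) :
    yDer e i t (yDer e j u q) = yDer e j u (yDer e i t q) :=
  derivation_comm_of_const _ _ (exists_yDer_X_eq_C e i t) (exists_yDer_X_eq_C e j u) q

section Heisenberg

variable (e : ℕ → ℕ → ℂ) (lam : ℕ → ℂ) (i : ℕ)

lemma bop_pos (t : {m : ℕ // 1 ≤ m}) (q : FSp n) :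
    bop n e lam i (t : ℕ) q = (t : ℂ) • yDer e i t q := by
  obtain ⟨t, ht⟩ := t
  rw [bop, dif_pos (by simp; omega), yDer_apply]
  simp

lemma bop_zero (q : FSp n) : bop n e lam i 0 q = lam i • q := by
  simp [bop]

lemma bop_neg (t : {m : ℕ // 1 ≤ m}) (q : FSp n) :
    bop n e lam i (-((t : ℕ) : ℤ)) q = yPoly n e i t * q := by
  obtain ⟨t, ht⟩ := t
  rw [bop, dif_neg (by simp), dif_neg (by simp; omega)]
  simp

lemma pos_or_zero_or_neg (m : ℤ) :
    (∃ t : {m : ℕ // 1 ≤ m}, m = (t : ℕ)) ∨ m = 0 ∨ ∃ t : {m : ℕ // 1 ≤ m}, m = -((t : ℕ) : ℤ) := by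
  rcases lt_trichotomy m 0 with h | h | h
  · exact Or.inr (Or.inr ⟨⟨m.natAbs, by omega⟩, by simp only; omega⟩)
  · exact Or.inr (Or.inl h)
  · exact Or.inl ⟨⟨m.natAbs, by omega⟩, by simp only; omega⟩

variable (n) in
/-- The operator `b_{i,m}` as a linear endomorphism. -/
noncomputable def bEnd (m : ℤ) : Module.End ℂ (FSp n) where
  toFun := bop n e lam i m
  map_add' p q := by
    obtain ⟨t, rfl⟩ | rfl | ⟨t, rfl⟩ := pos_or_zero_or_neg m
    · simp only [bop_pos, map_add, smul_add]
    · simp only [bop_zero, smul_add]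
    · simp only [bop_neg, mul_add]
  map_smul' c q := by
    obtain ⟨t, rfl⟩ | rfl | ⟨t, rfl⟩ := pos_or_zero_or_neg m
    · simp only [bop_pos, Derivation.map_smul, RingHom.id_apply]
      exact smul_comm _ _ _
    · simp only [bop_zero, RingHom.id_apply]
      exact smul_comm _ _ _
    · simp only [bop_neg, mul_smul_comm, RingHom.id_apply]

lemma lie_bEnd_eq_zero (T : Module.End ℂ (FSp n))
    (h₁ : ∀ i t q, T (yDer e i t q) = yDer e i t (T q))
    (h₂ : ∀ i t q, T (yPoly n e i t * q) = yPoly n e i t * T q) (m : ℤ) :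
    ⁅bEnd n e lam i m, T⁆ = 0 := by
  rw [LieRing.of_associative_ring_bracket, sub_eq_zero]
  refine LinearMap.ext fun q => ?_
  change bop n e lam i m (T q) = T (bop n e lam i m q)
  obtain ⟨t, rfl⟩ | rfl | ⟨t, rfl⟩ := pos_or_zero_or_neg m
  · rw [bop_pos, bop_pos, T.map_smul, h₁]
  · rw [bop_zero, bop_zero, T.map_smul]
  · rw [bop_neg, bop_neg, h₂]

lemma lie_bEnd_aEnd (m : ℤ) (v : PosRoot n) (s : ℤ) : ⁅bEnd n e lam i m, aEnd r v s⁆ = 0 := by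
  refine lie_bEnd_eq_zero e lam i _ (fun i t q => ?_) (fun i t q => ?_) m
  · change aop n r v.1.1 v.1.2 s _ = yDer e i t (aop n r v.1.1 v.1.2 s q)
    by_cases h : 0 ≤ s ∧ v.1.2 ≤ r
    · simp only [aop_of_pol h]
      exact derivation_comm_of_const _ _ (exists_pderiv_X_eq_C _) (exists_yDer_X_eq_C e i t) q
    · simp only [aop_of_not_pol h]
      exact (derivation_mul_of_eq_zero _ (yDer_X_inl e i t _) q).symm
  · change aop n r v.1.1 v.1.2 s _ = yPoly n e i t * aop n r v.1.1 v.1.2 s q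
    by_cases h : 0 ≤ s ∧ v.1.2 ≤ r
    · simp only [aop_of_pol h]
      exact derivation_mul_of_eq_zero _ (pderiv_inl_yPoly e i t _) q
    · simp only [aop_of_not_pol h]
      exact mul_left_comm _ _ _

lemma lie_bEnd_aStarEnd (m : ℤ) (v : PosRoot n) (s : ℤ) :
    ⁅bEnd n e lam i m, aStarEnd r v s⁆ = 0 := by
  refine lie_bEnd_eq_zero e lam i _ (fun i t q => ?_) (fun i t q => ?_) m
  · change astarop n r v.1.1 v.1.2 s _ = yDer e i t (astarop n r v.1.1 v.1.2 s q)
    by_cases h : s ≤ 0 ∧ v.1.2 ≤ r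
    · simp only [astarop_of_pol h]
      exact (derivation_mul_of_eq_zero _ (yDer_X_inl e i t _) q).symm
    · simp only [astarop_of_not_pol h, map_neg]
      rw [derivation_comm_of_const _ _ (exists_pderiv_X_eq_C _) (exists_yDer_X_eq_C e i t) q]
  · change astarop n r v.1.1 v.1.2 s _ = yPoly n e i t * astarop n r v.1.1 v.1.2 s q
    by_cases h : s ≤ 0 ∧ v.1.2 ≤ r
    · simp only [astarop_of_pol h]
      exact mul_left_comm _ _ _
    · simp only [astarop_of_not_pol h]
      rw [derivation_mul_of_eq_zero _ (pderiv_inl_yPoly e i t _) q, mul_neg]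

lemma bop_pos_bop_neg (j : ℕ) (t u : {m : ℕ // 1 ≤ m}) (q : FSp n) :
    bop n e lam i (t : ℕ) (bop n e lam j (-((u : ℕ) : ℤ)) q) -
      bop n e lam j (-((u : ℕ) : ℤ)) (bop n e lam i (t : ℕ) q) =
      ((if t = u then (t : ℂ) else 0) * ∑ k : Fin n, e i (k.1 + 1) * e j (k.1 + 1)) • q := by
  simp only [bop_pos, bop_neg]
  rw [Derivation.leibniz, yDer_yPoly, smul_eq_mul, smul_eq_mul, mul_comm q, ← smul_eq_C_mul,
    smul_add, mul_smul_comm, add_sub_cancel_left, smul_smul]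
  split_ifs <;> simp

lemma lie_bEnd_bEnd (j : ℕ) (m p : ℤ) :
    ⁅bEnd n e lam i m, bEnd n e lam j p⁆ =
      ((if m + p = 0 then m else 0 : ℂ) *
        ∑ k : Fin n, e i (k.1 + 1) * e j (k.1 + 1)) • 1 := by
  rw [LieRing.of_associative_ring_bracket]
  refine LinearMap.ext fun q => ?_
  change bop n e lam i m (bop n e lam j p q) - bop n e lam j p (bop n e lam i m q) =
    ((if m + p = 0 then (m : ℂ) else 0) * ∑ k : Fin n, e i (k.1 + 1) * e j (k.1 + 1)) • q
  obtain ⟨t, rfl⟩ | rfl | ⟨t, rfl⟩ := pos_or_zero_or_neg m <;>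
    obtain ⟨u, rfl⟩ | rfl | ⟨u, rfl⟩ := pos_or_zero_or_neg p
  · have := t.2
    rw [if_neg (by omega), zero_mul, zero_smul, sub_eq_zero]
    simp only [bop_pos, Derivation.map_smul]
    rw [yDer_comm, smul_comm]
  · have := t.2
    rw [if_neg (by omega), zero_mul, zero_smul, sub_eq_zero]
    simp only [bop_pos, bop_zero, Derivation.map_smul]
    rw [smul_comm]
  · rw [bop_pos_bop_neg]
    by_cases h : t = u
    · subst h
      simp
    · rw [if_neg h, if_neg fun h' => h (Subtype.ext (by omega))]
  · have := u.2
    rw [if_neg (by omega), zero_mul, zero_smul, sub_eq_zero]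
    simp only [bop_pos, bop_zero, Derivation.map_smul]
    rw [smul_comm]
  · simp only [bop_zero, Int.cast_zero, ite_self, zero_mul, zero_smul]
    rw [smul_comm, sub_self]
  · have := u.2
    rw [if_neg (by omega), zero_mul, zero_smul, sub_eq_zero]
    simp only [bop_neg, bop_zero, mul_smul_comm]
  · rw [← neg_sub, bop_pos_bop_neg, ← neg_smul]
    congr 1
    rw [← neg_mul]
    congr 1
    · by_cases h : u = t
      · subst h
        simp
      · rw [if_neg h, if_neg fun h' => h (Subtype.ext (by omega)), neg_zero]
    · exact Finset.sum_congr rfl fun k _ => mul_comm _ _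
  · have := t.2
    rw [if_neg (by omega), zero_mul, zero_smul, sub_eq_zero]
    simp only [bop_neg, bop_zero, mul_smul_comm]
  · have := t.2
    rw [if_neg (by omega), zero_mul, zero_smul, sub_eq_zero]
    simp only [bop_neg]
    exact mul_left_comm _ _ _

end Heisenberg

end Fock

section Main

variable {n : ℕ} (r : ℕ) (e : ℕ → ℕ → ℂ) (lam : ℕ → ℂ)

lemma nAAmode_eq_rootCurrent {k l : ℕ} (h : 1 ≤ k ∧ k ≤ l ∧ l ≤ n) (m : ℤ) (q : FSp n) :
    nAAmode n r k l k l m q = rootCurrent (fockBetaGamma n r) k l m q := by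
  rw [rootCurrent, dif_pos h]
  refine finsum_congr fun s => ?_
  change nAA n r k l k l s (m - s) q =
    (fockBetaGamma n r).nPair (⟨(k, l), h⟩ : PosRoot n) s (m - s) q
  unfold nAA BetaGammaFamily.nPair
  by_cases hs : 0 ≤ s ∧ l ≤ r
  · have hs' : 0 ≤ s ∧ (fockBetaGamma n r).pol ⟨(k, l), h⟩ := hs
    rw [if_pos hs, if_pos hs']
    rfl
  · have hs' : ¬(0 ≤ s ∧ (fockBetaGamma n r).pol ⟨(k, l), h⟩) := hs
    rw [if_neg hs, if_neg hs']
    rfl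

lemma rhoH_eq_cartanCurrent {i : ℕ} (hi : 1 ≤ i) (hi' : i ≤ n) (m : ℤ) (q : FSp n) :
    rhoH n r e lam i m q = cartanCurrent (fockBetaGamma n r) (bEnd n e lam) i m q := by
  rw [cartanCurrent, coordCurrent_sub_coordCurrent_succ hi hi', rhoH]
  simp only [LinearMap.add_apply, LinearMap.smul_apply, LinearMap.sum_apply, LinearMap.sub_apply]
  rw [nAAmode_eq_rootCurrent r ⟨hi, le_rfl, hi'⟩]
  congr 1
  congr 1
  · congr 1
    refine Finset.sum_congr rfl fun j hj => ?_
    rw [Finset.mem_Ico] at hj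
    rw [nAAmode_eq_rootCurrent r (by omega), nAAmode_eq_rootCurrent r (by omega)]
  · refine Finset.sum_congr rfl fun j hj => ?_
    rw [Finset.mem_Icc] at hj
    rw [nAAmode_eq_rootCurrent r (by omega), nAAmode_eq_rootCurrent r (by omega)]

end Main

/-- relation (R1):
`[ρ(H_i)_m, ρ(H_j)_p] = (α_i|α_j) · c₀ · m · δ_{m+p,0} · id`, with `c₀ = γ² − (r+1)`. -/
theorem wakimoto_R1 (n r : ℕ) (γ : ℂ) (e : ℕ → ℕ → ℂ) (lam : ℕ → ℂ)
    (hn : 1 ≤ n) (hr : r ≤ n)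
    (he : ∀ i j, 1 ≤ i → i ≤ n → 1 ≤ j → j ≤ n →
      (∑ k : Fin n, e i (k.1 + 1) * e j (k.1 + 1)) = Bentry r γ i j)
    (i j : ℕ) (hi : 1 ≤ i) (hi' : i ≤ n) (hj : 1 ≤ j) (hj' : j ≤ n) (m p : ℤ) :
    opComm n (rhoH n r e lam i m) (rhoH n r e lam j p) =
      fun q => (cartanEntry i j * (γ ^ 2 - ((r : ℂ) + 1)) * (m : ℂ) *
        (if m + p = 0 then 1 else 0)) • q := by
  have hB := lie_bEnd_bEnd e lam i j (n := n) m p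
  rw [he i j hi hi' hj hj'] at hB
  have h := lie_cartanCurrent (G := fockBetaGamma n r) hr (fun _ => Iff.rfl) γ
    (lie_bEnd_aEnd r e lam) (lie_bEnd_aStarEnd r e lam) hi hi' hj hj' m p hB
  funext q
  have hq := LinearMap.congr_fun h q
  unfold opComm
  rw [rhoH_eq_cartanCurrent r e lam hi hi', rhoH_eq_cartanCurrent r e lam hj hj',
    rhoH_eq_cartanCurrent r e lam hj hj', rhoH_eq_cartanCurrent r e lam hi hi']
  exact hq
end

section
/- For all 1 ≤ i, j ≤ n and all m, p ∈ ℤ, the intermediate Wakimoto operators satisfy relation (R2): [ρ(H_i)_m, ρ(E_j)_p] = (α_i|α_j) · ρ(E_j)_{m+p}, where (α_i|α_j) = (A_n)_{ij}. -/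
open MvPolynomial

section LocallyFiniteSums

variable {V : Type*} [AddCommGroup V] [Module ℂ V]

theorem endLie_smul (c : ℂ) (x y : Module.End ℂ V) : ⁅x, c • y⁆ = c • ⁅x, y⁆ := by
  simp only [Ring.lie_def, smul_mul_assoc, mul_smul_comm, smul_sub]

theorem smul_endLie (c : ℂ) (x y : Module.End ℂ V) : ⁅c • x, y⁆ = c • ⁅x, y⁆ := by
  simp only [Ring.lie_def, smul_mul_assoc, mul_smul_comm, smul_sub]

theorem endLie_sum {ι : Type*} (S : Finset ι) (x : Module.End ℂ V) (y : ι → Module.End ℂ V) :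
    ⁅x, ∑ i ∈ S, y i⁆ = ∑ i ∈ S, ⁅x, y i⁆ := by
  simp only [Ring.lie_def, Finset.mul_sum, Finset.sum_mul, Finset.sum_sub_distrib]

theorem sum_endLie {ι : Type*} (S : Finset ι) (x : ι → Module.End ℂ V) (y : Module.End ℂ V) :
    ⁅∑ i ∈ S, x i, y⁆ = ∑ i ∈ S, ⁅x i, y⁆ := by
  simp only [Ring.lie_def, Finset.mul_sum, Finset.sum_mul, Finset.sum_sub_distrib]

theorem endLie_one (x : Module.End ℂ V) : ⁅x, (1 : Module.End ℂ V)⁆ = 0 := by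
  simp [Ring.lie_def]

theorem one_endLie (x : Module.End ℂ V) : ⁅(1 : Module.End ℂ V), x⁆ = 0 := by
  simp [Ring.lie_def]

theorem endLie_add (x y z : Module.End ℂ V) : ⁅x, y + z⁆ = ⁅x, y⁆ + ⁅x, z⁆ := by
  simp only [Ring.lie_def, mul_add, add_mul]
  abel

theorem add_endLie (x y z : Module.End ℂ V) : ⁅x + y, z⁆ = ⁅x, z⁆ + ⁅y, z⁆ := by
  simp only [Ring.lie_def, mul_add, add_mul]
  abel

theorem endLie_sub (x y z : Module.End ℂ V) : ⁅x, y - z⁆ = ⁅x, y⁆ - ⁅x, z⁆ := by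
  simp only [Ring.lie_def, mul_sub, sub_mul]
  abel

theorem sub_endLie (x y z : Module.End ℂ V) : ⁅x - y, z⁆ = ⁅x, z⁆ - ⁅y, z⁆ := by
  simp only [Ring.lie_def, mul_sub, sub_mul]
  abel

theorem endLie_skew (x y : Module.End ℂ V) : -⁅y, x⁆ = ⁅x, y⁆ := by
  simp only [Ring.lie_def, neg_sub]

theorem neg_smul_end (c : ℂ) (x : Module.End ℂ V) : -(c • x) = (-c) • x :=
  (neg_smul c x).symm

theorem smul_sub_smul_end (c d : ℂ) (x : Module.End ℂ V) : c • x - d • x = (c - d) • x :=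
  (sub_smul c d x).symm

theorem endLie_neg (x y : Module.End ℂ V) : ⁅x, -y⁆ = -⁅x, y⁆ := by
  simp only [Ring.lie_def, mul_neg, neg_mul]
  abel

theorem neg_endLie (x y : Module.End ℂ V) : ⁅-x, y⁆ = -⁅x, y⁆ := by
  simp only [Ring.lie_def, mul_neg, neg_mul]
  abel

theorem endLie_zero (x : Module.End ℂ V) : ⁅x, (0 : Module.End ℂ V)⁆ = 0 := by
  simp [Ring.lie_def]

theorem zero_endLie (x : Module.End ℂ V) : ⁅(0 : Module.End ℂ V), x⁆ = 0 := by
  simp [Ring.lie_def]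

/-- A family of operators is locally finite if every vector is killed by all but finitely many
members. -/
def LocFin {ι : Type*} (f : ι → Module.End ℂ V) : Prop :=
  ∀ q, (fun i => f i q).HasFiniteSupport

/-- A family of operators indexed by `ℤ` is eventually zero on every vector. -/
def EvZero (f : ℤ → Module.End ℂ V) : Prop :=
  ∀ q, ∃ N : ℤ, ∀ s, N < s → f s q = 0

open Classical in
/-- The sum of a locally finite family of operators (and `0` for other families). -/
noncomputable def lfSum {ι : Type*} (f : ι → Module.End ℂ V) : Module.End ℂ V :=
  if h : LocFin f then
    { toFun := fun q => ∑ᶠ i, f i q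
      map_add' := fun x y => by
        simp only [map_add]
        exact finsum_add_distrib (h x) (h y)
      map_smul' := fun c x => by
        simp only [map_smul, RingHom.id_apply]
        exact (smul_finsum c _).symm }
  else 0

theorem lfSum_apply {ι : Type*} {f : ι → Module.End ℂ V} (h : LocFin f) (q : V) :
    lfSum f q = ∑ᶠ i, f i q := by
  simp [lfSum, h]

namespace LocFin

variable {ι : Type*} {f g : ι → Module.End ℂ V}

theorem of_finite (h : (Function.support f).Finite) : LocFin f := fun q =>
  h.subset fun i hi hfi => hi (by simp [hfi])

theorem add (hf : LocFin f) (hg : LocFin g) : LocFin fun i => f i + g i := fun q =>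
  ((hf q).union (hg q)).subset fun i hi => by
    by_contra hc
    simp only [Set.mem_union, Function.mem_support, not_or, not_not] at hc
    exact hi (by simp [hc.1, hc.2])

theorem mul_left (hf : LocFin f) (g : ι → Module.End ℂ V) : LocFin fun i => g i * f i :=
  fun q => (hf q).subset fun i hi hfi => hi (by simp [hfi])

theorem smul (hf : LocFin f) (c : ι → ℂ) : LocFin fun i => c i • f i := fun q =>
  (hf q).subset fun i hi hfi => hi (by simp [hfi])

theorem mul_right (hf : LocFin f) (D : Module.End ℂ V) : LocFin fun i => f i * D :=
  fun q => hf (D q)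

theorem comp_injective {κ : Type*} (hf : LocFin f) {e : κ → ι} (he : e.Injective) :
    LocFin fun i => f (e i) :=
  fun q => (hf q).preimage he.injOn

theorem lie (hf : LocFin f) (D : Module.End ℂ V) : LocFin fun i => ⁅D, f i⁆ := by
  have h := (hf.mul_left fun _ => D).add ((hf.mul_right D).smul fun _ => -1)
  convert h using 2 with i
  rw [Ring.lie_def, sub_eq_add_neg, neg_one_smul]

end LocFin

theorem lfSum_add {ι : Type*} {f g : ι → Module.End ℂ V} (hf : LocFin f) (hg : LocFin g) :
    lfSum (fun i => f i + g i) = lfSum f + lfSum g := by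
  ext q
  rw [LinearMap.add_apply, lfSum_apply (hf.add hg), lfSum_apply hf, lfSum_apply hg]
  exact finsum_add_distrib (hf q) (hg q)

theorem lfSum_smul {ι : Type*} {f : ι → Module.End ℂ V} (hf : LocFin f) (c : ℂ) :
    lfSum (fun i => c • f i) = c • lfSum f := by
  ext q
  rw [LinearMap.smul_apply, lfSum_apply (hf.smul fun _ => c), lfSum_apply hf, smul_finsum]
  rfl

theorem lfSum_shift {f : ℤ → Module.End ℂ V} (hf : LocFin f) (m : ℤ) :
    lfSum (fun s => f (s + m)) = lfSum f := by
  ext q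
  rw [lfSum_apply (hf.comp_injective (add_left_injective m)), lfSum_apply hf]
  exact finsum_comp_equiv (Equiv.addRight m) (f := fun s => f s q)

theorem locFin_single {f : ℤ → Module.End ℂ V} {t : ℤ} (h : ∀ s, s ≠ t → f s = 0) : LocFin f :=
  LocFin.of_finite ((Set.finite_singleton t).subset fun s hs => by
    by_contra hc
    exact hs (h s hc))

theorem lfSum_single {f : ℤ → Module.End ℂ V} {t : ℤ} (h : ∀ s, s ≠ t → f s = 0) :
    lfSum f = f t := by
  ext q
  rw [lfSum_apply (locFin_single h)]
  exact finsum_eq_single _ t fun s hs => by simp [h s hs]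

theorem lfSum_smul_const {c : ℤ → ℂ} (hc : c.HasFiniteSupport) (T : Module.End ℂ V) :
    lfSum (fun s => c s • T) = (∑ᶠ s, c s) • T := by
  have hfin : LocFin fun s => c s • T :=
    LocFin.of_finite (hc.subset fun s hs h => hs (by simp [h]))
  ext q
  rw [lfSum_apply hfin, LinearMap.smul_apply, finsum_smul]
  rfl

theorem lie_lfSum {ι : Type*} {f : ι → Module.End ℂ V} (hf : LocFin f) (D : Module.End ℂ V) :
    ⁅D, lfSum f⁆ = lfSum fun i => ⁅D, f i⁆ := by
  ext q
  have h1 : (fun i => D (f i q)).HasFiniteSupport := hf.mul_left (fun _ => D) q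
  rw [lfSum_apply (hf.lie D)]
  simp only [Ring.lie_def, LinearMap.sub_apply, Module.End.mul_apply]
  rw [finsum_sub_distrib h1 (hf (D q)), lfSum_apply hf, lfSum_apply hf]
  congr 1
  exact D.toAddMonoidHom.map_finsum (hf q)

/-- The product of `x` and `y`, with `x` moved to the right of `y` if `c` holds. -/
def nordMul (c : Prop) [Decidable c] (x y : Module.End ℂ V) : Module.End ℂ V :=
  if c then y * x else x * y

/-- The sum of `c s - c (s + m)` over `s`, for the indicator `c` of `ann`, is finite with
value `ν`. -/
def HasShiftDefect (ann : ℤ → Prop) [DecidablePred ann] (m : ℤ) (ν : ℂ) : Prop :=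
  (fun s => (if ann s then (1 : ℂ) else 0) - if ann (s + m) then 1 else 0).HasFiniteSupport ∧
    ∑ᶠ s, ((if ann s then (1 : ℂ) else 0) - if ann (s + m) then 1 else 0) = ν

theorem HasShiftDefect.congr {c d : ℤ → Prop} [DecidablePred c] [DecidablePred d] {m : ℤ} {ν : ℂ}
    (h : HasShiftDefect c m ν) (hcd : ∀ s, d s ↔ c s) : HasShiftDefect d m ν := by
  unfold HasShiftDefect at h ⊢
  simpa only [hcd] using h

theorem nordMul_congr {c d : Prop} [Decidable c] [Decidable d] (h : c ↔ d)
    (x y : Module.End ℂ V) : nordMul c x y = nordMul d x y := by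
  simp only [nordMul, h]

theorem nordMul_of_commute (c d : Prop) [Decidable c] [Decidable d] {x y : Module.End ℂ V}
    (h : ⁅x, y⁆ = 0) : nordMul c x y = nordMul d x y := by
  rw [Ring.lie_def, sub_eq_zero] at h
  simp only [nordMul, h, ite_self]

theorem lie_nordMul {D x y : Module.End ℂ V} {α β : ℂ} (c : Prop) [Decidable c]
    (hx : ⁅D, x⁆ = α • 1) (hy : ⁅D, y⁆ = β • 1) :
    ⁅D, nordMul c x y⁆ = α • y + β • x := by
  rw [Ring.lie_def, sub_eq_iff_eq_add'] at hx hy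
  unfold nordMul
  split_ifs
  · rw [Ring.lie_def, ← mul_assoc, hy, add_mul, mul_assoc, hx]
    simp only [mul_add, smul_mul_assoc, mul_smul_comm, mul_one, one_mul, mul_assoc]
    abel
  · rw [Ring.lie_def, ← mul_assoc, hx, add_mul, mul_assoc, hy]
    simp only [mul_add, smul_mul_assoc, mul_smul_comm, mul_one, one_mul, mul_assoc]
    abel

theorem hasShiftDefect_const (c : Prop) [Decidable c] (m : ℤ) :
    HasShiftDefect (fun _ => c) m 0 := by
  simp [HasShiftDefect, Function.HasFiniteSupport]

theorem hasShiftDefect_le (k m : ℤ) : HasShiftDefect (fun s => k ≤ s) m (-m) := by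
  rcases le_total 0 m with hm | hm
  · have h : (fun s => (if k ≤ s then (1 : ℂ) else 0) - if k ≤ s + m then 1 else 0)
        = fun s => if s ∈ Finset.Ico (k - m) k then -1 else 0 := by
      funext s
      simp only [Finset.mem_Ico]
      split_ifs <;> first | omega | norm_num
    have hs : Function.support (fun s => if s ∈ Finset.Ico (k - m) k then (-1 : ℂ) else 0)
        ⊆ (Finset.Ico (k - m) k : Finset ℤ) := fun s hs => by
      by_contra hc
      exact hs (if_neg hc)
    unfold HasShiftDefect
    rw [h, finsum_eq_sum_of_support_subset _ hs]
    refine ⟨(Finset.finite_toSet _).subset hs, ?_⟩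
    rw [Finset.sum_congr rfl fun s hs => if_pos hs, Finset.sum_const, Int.card_Ico, nsmul_eq_mul]
    have : ((k - (k - m)).toNat : ℤ) = m := by omega
    have h2 : (((k - (k - m)).toNat : ℤ) : ℂ) = m := by rw [this]
    push_cast at h2
    rw [h2]; ring
  · have h : (fun s => (if k ≤ s then (1 : ℂ) else 0) - if k ≤ s + m then 1 else 0)
        = fun s => if s ∈ Finset.Ico k (k - m) then 1 else 0 := by
      funext s
      simp only [Finset.mem_Ico]
      split_ifs <;> first | omega | norm_num
    have hs : Function.support (fun s => if s ∈ Finset.Ico k (k - m) then (1 : ℂ) else 0)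
        ⊆ (Finset.Ico k (k - m) : Finset ℤ) := fun s hs => by
      by_contra hc
      exact hs (if_neg hc)
    unfold HasShiftDefect
    rw [h, finsum_eq_sum_of_support_subset _ hs]
    refine ⟨(Finset.finite_toSet _).subset hs, ?_⟩
    rw [Finset.sum_congr rfl fun s hs => if_pos hs, Finset.sum_const, Int.card_Ico, nsmul_eq_mul]
    have : ((k - m - k).toNat : ℤ) = -m := by omega
    have h2 : (((k - m - k).toNat : ℤ) : ℂ) = ((-m : ℤ) : ℂ) := by rw [this]
    push_cast at h2
    rw [h2]; ring

/-- Commutator of an operator of degree `m` with a mode of a normally ordered product. -/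
theorem lie_lfSum_nordMul (H : Module.End ℂ V) (f g K : ℤ → Module.End ℂ V) (ann : ℤ → Prop)
    [DecidablePred ann] (m : ℤ) {α β κ ν : ℂ}
    (hf : ∀ s, ⁅H, f s⁆ = α • f (s + m))
    (hg : ∀ u, ⁅H, g u⁆ = β • g (u + m) + (if m + u = 0 then κ else 0) • 1)
    (hK : ∀ s u, ⁅g u, f s⁆ = K (s + u))
    (hfin : ∀ p, LocFin fun s => nordMul (ann s) (f s) (g (p - s)))
    (hann : HasShiftDefect ann m ν) (p : ℤ) :
    ⁅H, lfSum fun s => nordMul (ann s) (f s) (g (p - s))⁆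
      = (α + β) • lfSum (fun s => nordMul (ann s) (f s) (g (m + p - s)))
        + (α * ν) • K (m + p) + κ • f (m + p) := by
  have key : ∀ s, ⁅H, nordMul (ann s) (f s) (g (p - s))⁆ =
      (α • nordMul (ann (s + m)) (f (s + m)) (g (m + p - (s + m)))
        + β • nordMul (ann s) (f s) (g (m + p - s)))
      + ((((if ann s then (1 : ℂ) else 0) - if ann (s + m) then 1 else 0) • (α • K (m + p)))
        + (if s = m + p then κ else 0) • f s) := by
    intro s
    have h1 : H * f s = f s * H + α • f (s + m) := by rw [← hf, Ring.lie_def]; abel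
    have h2 : H * g (p - s) = g (p - s) * H + (β • g (m + p - s)
        + (if s = m + p then κ else 0) • 1) := by
      have h := hg (p - s)
      rw [Ring.lie_def, show p - s + m = m + p - s by ring] at h
      rw [sub_eq_iff_eq_add'.mp h]
      have : (m + (p - s) = 0) ↔ s = m + p := by omega
      simp only [this]
    have h3 : g (p - s) * f (s + m) = f (s + m) * g (p - s) + K (m + p) := by
      have h := hK (s + m) (p - s)
      rw [Ring.lie_def, show s + m + (p - s) = m + p by ring] at h
      rw [sub_eq_iff_eq_add'.mp h]
    rw [show m + p - (s + m) = p - s by ring]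
    have h12 : ⁅H, f s * g (p - s)⁆ = α • (f (s + m) * g (p - s)) + β • (f s * g (m + p - s))
        + (if s = m + p then κ else 0) • f s := by
      rw [Ring.lie_def, ← mul_assoc, h1, add_mul, mul_assoc, h2]
      simp only [mul_add, smul_mul_assoc, mul_smul_comm, mul_one, mul_assoc]
      abel
    have h21 : ⁅H, g (p - s) * f s⁆ = α • (g (p - s) * f (s + m)) + β • (g (m + p - s) * f s)
        + (if s = m + p then κ else 0) • f s := by
      rw [Ring.lie_def, ← mul_assoc, h2, add_mul, mul_assoc, h1]
      simp only [mul_add, add_mul, smul_mul_assoc, mul_smul_comm, one_mul, mul_assoc]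
      abel
    unfold nordMul
    by_cases c1 : ann s <;> by_cases c2 : ann (s + m) <;>
      simp only [c1, c2, if_true, if_false, h12, h21, h3, smul_add, sub_self, zero_smul, sub_zero,
        one_smul, zero_sub, neg_smul] <;> abel
  have l1 : LocFin fun s => nordMul (ann (s + m)) (f (s + m)) (g (m + p - (s + m))) :=
    (hfin (m + p)).comp_injective (add_left_injective m)
  have l3 : LocFin fun s =>
      ((if ann s then (1 : ℂ) else 0) - if ann (s + m) then 1 else 0) • (α • K (m + p)) :=
    LocFin.of_finite (hann.1.subset fun s hs h => hs (by simp only [h, zero_smul]))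
  have h4 : ∀ s, s ≠ m + p → (if s = m + p then κ else 0) • f s = 0 := fun s hs => by simp [hs]
  rw [lie_lfSum (hfin p)]
  simp only [key]
  rw [lfSum_add ((l1.smul _).add ((hfin _).smul _)) (l3.add (locFin_single h4)),
    lfSum_add (l1.smul _) ((hfin _).smul _), lfSum_add l3 (locFin_single h4),
    lfSum_smul l1, lfSum_smul (hfin _), lfSum_smul_const hann.1, hann.2, lfSum_single h4,
    lfSum_shift (hfin (m + p)) m, if_pos rfl, smul_smul, mul_comm ν α, add_smul]
  abel

/-- Commutator of an operator of degree `m` with a mode of a product of two commuting fields. -/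
theorem lie_lfSum_mul (H : Module.End ℂ V) (f g : ℤ → Module.End ℂ V) (m : ℤ) {α β κ : ℂ}
    (hf : ∀ s, ⁅H, f s⁆ = α • f (s + m))
    (hg : ∀ u, ⁅H, g u⁆ = β • g (u + m) + (if m + u = 0 then κ else 0) • 1)
    (hfg : ∀ s u, ⁅f s, g u⁆ = 0) (hfin : ∀ p, LocFin fun s => f s * g (p - s)) (p : ℤ) :
    ⁅H, lfSum fun s => f s * g (p - s)⁆
      = (α + β) • lfSum (fun s => f s * g (m + p - s)) + κ • f (m + p) := by
  have h := lie_lfSum_nordMul H f g (fun _ => 0) (fun _ => False) m hf hg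
    (fun s u => by rw [← endLie_skew, hfg, neg_zero]) hfin (hasShiftDefect_const False m) p
  rwa [smul_zero, add_zero] at h

theorem LocFin.mul_of_commute {ι : Type*} {f g : ι → Module.End ℂ V} {c : ι → Prop}
    [DecidablePred c] (h : ∀ i, ⁅f i, g i⁆ = 0) (hc : LocFin fun i => nordMul (c i) (f i) (g i)) :
    LocFin fun i => f i * g i := by
  convert hc using 2 with i
  rw [nordMul_of_commute (c i) False (h i), nordMul, if_neg id]

theorem LocFin.evZero {f : ℤ → Module.End ℂ V} (hf : LocFin f) : EvZero f := fun q => by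
  obtain ⟨N, hN⟩ := (hf q).bddAbove
  refine ⟨N, fun s hs => ?_⟩
  by_contra hc
  exact absurd (hN hc) (not_le.mpr hs)

theorem EvZero.exists_forall_mem {f : ℤ → Module.End ℂ V} (hf : EvZero f) (S : Finset V) :
    ∃ N : ℤ, ∀ q ∈ S, ∀ s, N < s → f s q = 0 := by
  classical
  choose N hN using hf
  obtain ⟨M, hM⟩ := (S.image N).bddAbove
  exact ⟨M, fun q hq s hs => hN q s
    ((hM (Finset.mem_coe.mpr (Finset.mem_image_of_mem N hq))).trans_lt hs)⟩

/-- The modes of the normally ordered product of two fields are locally finite sums. -/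
theorem EvZero.locFin_nordMul {f g : ℤ → Module.End ℂ V} (hf : EvZero f) (hg : EvZero g)
    (k p : ℤ) : LocFin fun s => nordMul (k ≤ s) (f s) (g (p - s)) := fun q => by
  obtain ⟨N, hN⟩ := hf q
  obtain ⟨M, hM⟩ := hg q
  refine (Set.finite_Icc (p - M) N |>.union (Set.finite_Icc k N) |>.union
    (Set.finite_Icc (p - M) k)).subset fun s hs => ?_
  by_contra hc
  simp only [Set.mem_union, Set.mem_Icc, not_or, not_and, not_le] at hc
  apply hs
  by_cases hk : k ≤ s
  · have : f s q = 0 := hN s (by omega)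
    simp [nordMul, hk, this]
  · have : g (p - s) q = 0 := hM _ (by omega)
    simp [nordMul, hk, this]

/-- The normally ordered product of two fields is a field. -/
theorem EvZero.lfSum_nordMul {f g : ℤ → Module.End ℂ V} (hf : EvZero f) (hg : EvZero g)
    (k : ℤ) : EvZero fun u => lfSum fun s => nordMul (k ≤ s) (f s) (g (u - s)) := fun q => by
  obtain ⟨N, hN⟩ := hf q
  obtain ⟨M, hM⟩ := hg q
  classical
  obtain ⟨L, hL⟩ := hg.exists_forall_mem ((Finset.Icc k N).image fun s => f s q)
  refine ⟨max (N + L) (M + k), fun u hu => ?_⟩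
  rw [lfSum_apply (hf.locFin_nordMul hg k u)]
  rw [max_lt_iff] at hu
  refine finsum_eq_zero_of_forall_eq_zero fun s => ?_
  by_cases hk : k ≤ s
  · by_cases hs : s ≤ N
    · have : g (u - s) (f s q) = 0 :=
        hL _ (Finset.mem_image_of_mem _ (Finset.mem_Icc.mpr ⟨hk, hs⟩)) _ (by omega)
      simp [nordMul, hk, this]
    · simp [nordMul, hk, hN s (by omega)]
  · simp [nordMul, hk, hM (u - s) (by omega)]

theorem EvZero.sub {f g : ℤ → Module.End ℂ V} (hf : EvZero f) (hg : EvZero g) :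
    EvZero fun s => f s - g s := fun q => by
  obtain ⟨N, hN⟩ := hf q
  obtain ⟨M, hM⟩ := hg q
  refine ⟨max N M, fun s hs => ?_⟩
  rw [max_lt_iff] at hs
  simp [hN s hs.1, hM s hs.2]

theorem EvZero.sum {ι : Type*} (S : Finset ι) {f : ι → ℤ → Module.End ℂ V}
    (hf : ∀ i ∈ S, EvZero (f i)) : EvZero fun s => ∑ i ∈ S, f i s := fun q => by
  choose! N hN using fun i hi => hf i hi q
  obtain ⟨M, hM⟩ := (S.image N).bddAbove
  refine ⟨M, fun s hs => ?_⟩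
  rw [LinearMap.sum_apply]
  exact Finset.sum_eq_zero fun i hi => hN i hi s
    ((hM (Finset.mem_coe.mpr (Finset.mem_image_of_mem N hi))).trans_lt hs)

end LocallyFiniteSums
section Modes

variable {σ : Type*}

/-- Partial differentiation, as an endomorphism. -/
noncomputable def pderivEnd (u : σ) : Module.End ℂ (MvPolynomial σ ℂ) :=
  (pderiv (R := ℂ) u).toLinearMap

/-- Multiplication by a polynomial, as an endomorphism. -/
noncomputable def mulEnd (u : MvPolynomial σ ℂ) : Module.End ℂ (MvPolynomial σ ℂ) :=
  LinearMap.mulLeft ℂ u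

theorem pderivEnd_apply (u : σ) (q : MvPolynomial σ ℂ) : pderivEnd u q = pderiv u q := rfl

theorem mulEnd_apply (u q : MvPolynomial σ ℂ) : mulEnd u q = u * q := rfl

/-- `aop` as a linear map. -/
noncomputable def aLin (n r i j : ℕ) (m : ℤ) : Module.End ℂ (FSp n) :=
  if h : 1 ≤ i ∧ i ≤ j ∧ j ≤ n then
    (if 0 ≤ m ∧ j ≤ r then pderivEnd (Sum.inl (⟨(i, j), h⟩, m))
     else mulEnd (X (Sum.inl (⟨(i, j), h⟩, m))))
  else 0

/-- `astarop` as a linear map. -/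
noncomputable def starLin (n r i j : ℕ) (m : ℤ) : Module.End ℂ (FSp n) :=
  if h : 1 ≤ i ∧ i ≤ j ∧ j ≤ n then
    (if m ≤ 0 ∧ j ≤ r then mulEnd (X (Sum.inl (⟨(i, j), h⟩, -m)))
     else -pderivEnd (Sum.inl (⟨(i, j), h⟩, -m)))
  else 0

/-- The Heisenberg mode attached to the variables `y_{k,m}`; its zero mode vanishes. -/
noncomputable def osc (n : ℕ) (k : Fin n) (m : ℤ) : Module.End ℂ (FSp n) :=
  if h : 0 < m then (m : ℂ) • pderivEnd (Sum.inr (k, ⟨m.toNat, by omega⟩))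
  else if h' : m = 0 then 0
  else mulEnd (X (Sum.inr (k, ⟨(-m).toNat, by omega⟩)))

/-- `bop` as a linear map. -/
noncomputable def bLin (n : ℕ) (e : ℕ → ℕ → ℂ) (lam : ℕ → ℂ) (i : ℕ) (m : ℤ) :
    Module.End ℂ (FSp n) :=
  ∑ k : Fin n, e i (k.1 + 1) • osc n k m + (if m = 0 then lam i else 0) • 1

theorem coe_aLin (n r i j : ℕ) (m : ℤ) : ⇑(aLin n r i j m) = aop n r i j m := by
  unfold aLin aop
  split_ifs <;> rfl

theorem coe_starLin (n r i j : ℕ) (m : ℤ) : ⇑(starLin n r i j m) = astarop n r i j m := by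
  unfold starLin astarop
  split_ifs <;> rfl

theorem coe_bLin (n : ℕ) (e : ℕ → ℕ → ℂ) (lam : ℕ → ℂ) (i : ℕ) (m : ℤ) :
    ⇑(bLin n e lam i m) = bop n e lam i m := by
  funext q
  unfold bLin bop osc
  split_ifs with h1 h2 h2
  · omega
  · simp [pderivEnd_apply, Finset.smul_sum, smul_comm (m : ℂ)]
  · simp
  · simp [mulEnd_apply, yPoly, Finset.sum_mul]

theorem lie_mulEnd_mulEnd (u v : MvPolynomial σ ℂ) : ⁅mulEnd u, mulEnd v⁆ = 0 := by
  refine LinearMap.ext fun q => ?_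
  simp only [Ring.lie_def, LinearMap.sub_apply, Module.End.mul_apply, mulEnd_apply,
    LinearMap.zero_apply]
  ring

theorem lie_pderivEnd_pderivEnd (u v : σ) : ⁅pderivEnd u, pderivEnd v⁆ = 0 := by
  classical
  have h : ⁅pderiv (R := ℂ) u, pderiv (R := ℂ) v⁆ = 0 := by
    refine derivation_ext fun i => ?_
    rw [Derivation.commutator_apply, pderiv_X, pderiv_X]
    simp only [Pi.single_apply]
    split_ifs <;> simp
  exact LinearMap.ext fun q =>
    congrArg (fun D : Derivation ℂ (MvPolynomial σ ℂ) (MvPolynomial σ ℂ) => D q) h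

theorem lie_pderivEnd_mulEnd [DecidableEq σ] (u v : σ) :
    ⁅pderivEnd u, mulEnd (X v)⁆ = if u = v then 1 else 0 := by
  refine LinearMap.ext fun q => ?_
  simp only [Ring.lie_def, LinearMap.sub_apply, Module.End.mul_apply, mulEnd_apply,
    pderivEnd_apply, Derivation.leibniz, pderiv_X, smul_eq_mul, Pi.single_apply]
  rw [add_sub_cancel_left]
  by_cases h : u = v
  · subst h; simp
  · simp [h, Ne.symm h]

theorem lie_mulEnd_pderivEnd [DecidableEq σ] (u v : σ) :
    ⁅mulEnd (X v), pderivEnd u⁆ = -if u = v then 1 else 0 := by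
  rw [← endLie_skew, lie_pderivEnd_mulEnd]

theorem locFin_pderivEnd {τ : Type*} {f : τ → σ} (hf : f.Injective) :
    LocFin fun t => pderivEnd (f t) := fun q =>
  ((q.vars.finite_toSet).preimage hf.injOn).subset fun t ht => by
    by_contra hc
    exact ht (pderiv_eq_zero_of_notMem_vars hc)

variable {n r : ℕ}

theorem lie_aLin_aLin (i j k l : ℕ) (s t : ℤ) : ⁅aLin n r i j s, aLin n r k l t⁆ = 0 := by
  unfold aLin
  split_ifs with h1 h2 h3 h4 h3 h4 h3 h4 <;>
    simp only [lie_mulEnd_mulEnd, lie_pderivEnd_pderivEnd, lie_mulEnd_pderivEnd,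
      lie_pderivEnd_mulEnd, zero_endLie, endLie_zero]
  · rw [if_neg]
    intro h
    simp only [Sum.inl.injEq, Prod.mk.injEq, Subtype.mk.injEq] at h
    omega
  · rw [if_neg, neg_zero]
    intro h
    simp only [Sum.inl.injEq, Prod.mk.injEq, Subtype.mk.injEq] at h
    omega

theorem lie_starLin_starLin (i j k l : ℕ) (s t : ℤ) :
    ⁅starLin n r i j s, starLin n r k l t⁆ = 0 := by
  unfold starLin
  split_ifs with h1 h2 h3 h4 h3 h4 h3 h4 <;>
    simp only [lie_mulEnd_mulEnd, lie_pderivEnd_pderivEnd, lie_mulEnd_pderivEnd,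
      lie_pderivEnd_mulEnd, zero_endLie, endLie_zero, neg_endLie, endLie_neg, neg_zero]
  · rw [if_neg, neg_zero, neg_zero]
    intro h
    simp only [Sum.inl.injEq, Prod.mk.injEq, Subtype.mk.injEq] at h
    omega
  · rw [if_neg, neg_zero]
    intro h
    simp only [Sum.inl.injEq, Prod.mk.injEq, Subtype.mk.injEq] at h
    omega

theorem lie_aLin_starLin {i j : ℕ} (hij : 1 ≤ i ∧ i ≤ j ∧ j ≤ n) (k l : ℕ) (s t : ℤ) :
    ⁅aLin n r i j s, starLin n r k l t⁆
      = (if (i = k ∧ j = l) ∧ s + t = 0 then (1 : ℂ) else 0) • 1 := by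
  unfold aLin starLin
  rw [dif_pos hij]
  by_cases hkl : 1 ≤ k ∧ k ≤ l ∧ l ≤ n
  · rw [dif_pos hkl]
    have hs : ((Sum.inl (⟨(i, j), hij⟩, s) : XIdx n ⊕ YIdx n) = Sum.inl (⟨(k, l), hkl⟩, -t))
        ↔ (i = k ∧ j = l) ∧ s + t = 0 := by
      simp only [Sum.inl.injEq, Prod.mk.injEq, Subtype.mk.injEq]
      omega
    have hs' := eq_comm.trans hs
    rw [ite_smul, one_smul, zero_smul]
    by_cases h1 : 0 ≤ s ∧ j ≤ r <;> by_cases h2 : t ≤ 0 ∧ l ≤ r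
    · rw [if_pos h1, if_pos h2, lie_pderivEnd_mulEnd]
      simp only [hs]
    · rw [if_pos h1, if_neg h2, endLie_neg, lie_pderivEnd_pderivEnd, neg_zero, if_neg]
      omega
    · rw [if_neg h1, if_pos h2, lie_mulEnd_mulEnd, if_neg]
      omega
    · rw [if_neg h1, if_neg h2, endLie_neg, lie_mulEnd_pderivEnd, neg_neg]
      simp only [hs']
  · rw [dif_neg hkl, endLie_zero, if_neg, zero_smul]
    rintro ⟨⟨rfl, rfl⟩, -⟩
    exact hkl hij

theorem evZero_aLin (i j : ℕ) (hj : j ≤ r) : EvZero (aLin n r i j) := by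
  by_cases h : 1 ≤ i ∧ i ≤ j ∧ j ≤ n
  · intro q
    obtain ⟨N, hN⟩ := (locFin_pderivEnd (σ := XIdx n ⊕ YIdx n)
      (f := fun s : ℤ => Sum.inl (⟨(i, j), h⟩, s)) (fun s t => by simp)).evZero q
    refine ⟨max N 0, fun s hs => ?_⟩
    rw [max_lt_iff] at hs
    rw [aLin, dif_pos h, if_pos ⟨hs.2.le, hj⟩]
    exact hN s hs.1
  · exact fun q => ⟨0, fun s _ => by simp [aLin, h]⟩

theorem locFin_pderivEnd_neg {i j : ℕ} (h : 1 ≤ i ∧ i ≤ j ∧ j ≤ n) :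
    LocFin fun s : ℤ => -pderivEnd (Sum.inl (⟨(i, j), h⟩, -s) : XIdx n ⊕ YIdx n) := by
  have := (locFin_pderivEnd (σ := XIdx n ⊕ YIdx n)
      (f := fun s : ℤ => Sum.inl (⟨(i, j), h⟩, -s)) (fun s t => by simp)).smul fun _ => -1
  convert this using 2 with s
  exact (neg_one_smul ℂ _).symm

theorem evZero_starLin (i j : ℕ) : EvZero (starLin n r i j) := by
  by_cases h : 1 ≤ i ∧ i ≤ j ∧ j ≤ n
  · intro q
    obtain ⟨N, hN⟩ := (locFin_pderivEnd_neg h).evZero q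
    refine ⟨max N 0, fun s hs => ?_⟩
    rw [max_lt_iff] at hs
    rw [starLin, dif_pos h, if_neg (by omega)]
    exact hN s hs.1
  · exact fun q => ⟨0, fun s _ => by simp [starLin, h]⟩

theorem locFin_starLin (i j : ℕ) (hj : r < j) : LocFin (starLin n r i j) := by
  by_cases h : 1 ≤ i ∧ i ≤ j ∧ j ≤ n
  · have h2 := locFin_pderivEnd_neg h
    convert h2 using 2 with s
    rw [starLin, dif_pos h, if_neg (by omega)]
  · exact LocFin.of_finite (Set.Finite.subset Set.finite_empty fun s hs =>
      hs (by simp [starLin, h]))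

theorem evZero_osc (k : Fin n) : EvZero (osc n k) := fun q => by
  obtain ⟨N, hN⟩ := ((locFin_pderivEnd (σ := XIdx n ⊕ YIdx n)
    (f := fun m : {m : ℕ // 1 ≤ m} => Sum.inr (k, m)) (fun s t => by simp) q).image
      fun m => (m.1 : ℤ)).bddAbove
  refine ⟨max N 0, fun s hs => ?_⟩
  rw [max_lt_iff] at hs
  rw [osc, dif_pos hs.2, LinearMap.smul_apply]
  by_contra hc
  have := hN ⟨⟨s.toNat, by omega⟩, fun h => hc ?_, rfl⟩
  · simp only at this
    omega
  · simp only at h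
    rw [h, smul_zero]

theorem evZero_bLin (e : ℕ → ℕ → ℂ) (lam : ℕ → ℂ) (i : ℕ) : EvZero (bLin n e lam i) := fun q => by
  choose N hN using fun k => evZero_osc (n := n) k q
  obtain ⟨M, hM⟩ := (Set.finite_range N).bddAbove
  refine ⟨max M 0, fun s hs => ?_⟩
  rw [max_lt_iff] at hs
  have h (k : Fin n) : osc n k s q = 0 := hN k s ((hM (Set.mem_range_self k)).trans_lt hs.1)
  simp [bLin, h, hs.2.ne']

theorem lie_osc_aLin (k : Fin n) (i j : ℕ) (s t : ℤ) : ⁅osc n k s, aLin n r i j t⁆ = 0 := by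
  unfold osc aLin
  split_ifs <;>
    simp only [smul_endLie, zero_endLie, endLie_zero, lie_mulEnd_mulEnd, lie_pderivEnd_pderivEnd,
      lie_mulEnd_pderivEnd, lie_pderivEnd_mulEnd, reduceCtorEq, if_false, smul_zero, neg_zero]

theorem lie_osc_starLin (k : Fin n) (i j : ℕ) (s t : ℤ) :
    ⁅osc n k s, starLin n r i j t⁆ = 0 := by
  unfold osc starLin
  split_ifs <;>
    simp only [smul_endLie, zero_endLie, endLie_zero, lie_mulEnd_mulEnd, lie_pderivEnd_pderivEnd,
      lie_mulEnd_pderivEnd, lie_pderivEnd_mulEnd, reduceCtorEq, if_false, smul_zero, neg_zero,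
      endLie_neg]

theorem lie_osc_osc (k l : Fin n) (s t : ℤ) :
    ⁅osc n k s, osc n l t⁆ = (if k = l ∧ s + t = 0 then (s : ℂ) else 0) • 1 := by
  have h0 (a : ℂ) (c : Prop) [Decidable c] : (a • if c then (1 : Module.End ℂ (FSp n)) else 0)
      = (if c then a else 0) • 1 := by split_ifs <;> simp
  unfold osc
  rcases lt_trichotomy 0 s with hs | hs | hs <;> rcases lt_trichotomy 0 t with ht | ht | ht
  · rw [dif_pos hs, dif_pos ht, smul_endLie, endLie_smul, lie_pderivEnd_pderivEnd,
      if_neg (by omega)]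
    simp
  · simp [← ht, endLie_zero, hs.ne']
  · have hc : (k = l ∧ s.toNat = (-t).toNat) ↔ (k = l ∧ s + t = 0) := by
      rw [and_congr_right_iff]
      omega
    rw [dif_pos hs, dif_neg ht.not_gt, dif_neg ht.ne, smul_endLie, lie_pderivEnd_mulEnd]
    simp only [Sum.inr.injEq, Prod.mk.injEq, Subtype.mk.injEq, h0, hc]
  · simp [← hs, zero_endLie]
  · simp [← hs, zero_endLie]
  · simp [← hs, zero_endLie]
  · have hc : (l = k ∧ t.toNat = (-s).toNat) ↔ (k = l ∧ s + t = 0) := by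
      rw [eq_comm, and_congr_right_iff]
      omega
    rw [dif_neg hs.not_gt, dif_neg hs.ne, dif_pos ht, endLie_smul, lie_mulEnd_pderivEnd, smul_neg,
      h0, neg_smul_end]
    simp only [Sum.inr.injEq, Prod.mk.injEq, Subtype.mk.injEq, hc]
    congr 1
    split_ifs with h
    · rw [eq_neg_of_add_eq_zero_left h.2, Int.cast_neg]
    · exact neg_zero
  · simp [← ht, endLie_zero, hs.ne]
  · rw [dif_neg hs.not_gt, dif_neg hs.ne, dif_neg ht.not_gt, dif_neg ht.ne, lie_mulEnd_mulEnd,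
      if_neg (by omega), zero_smul]

theorem lie_bLin_aLin (e : ℕ → ℕ → ℂ) (lam : ℕ → ℂ) (i k l : ℕ) (s t : ℤ) :
    ⁅bLin n e lam i s, aLin n r k l t⁆ = 0 := by
  simp only [bLin, add_endLie, sum_endLie, smul_endLie, lie_osc_aLin, one_endLie, smul_zero,
    Finset.sum_const_zero, add_zero]

theorem lie_bLin_starLin (e : ℕ → ℕ → ℂ) (lam : ℕ → ℂ) (i k l : ℕ) (s t : ℤ) :
    ⁅bLin n e lam i s, starLin n r k l t⁆ = 0 := by
  simp only [bLin, add_endLie, sum_endLie, smul_endLie, lie_osc_starLin, one_endLie, smul_zero,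
    Finset.sum_const_zero, add_zero]

theorem lie_bLin_bLin (e : ℕ → ℕ → ℂ) (lam : ℕ → ℂ) (i j : ℕ) (s t : ℤ) :
    ⁅bLin n e lam i s, bLin n e lam j t⁆ =
      (if s + t = 0 then s * ∑ k : Fin n, e i (k.1 + 1) * e j (k.1 + 1) else 0 : ℂ) • 1 := by
  simp only [bLin, add_endLie, sum_endLie, smul_endLie, endLie_add, endLie_sum, endLie_smul,
    lie_osc_osc, endLie_one, one_endLie, smul_zero, add_zero, smul_smul, ← Finset.sum_smul]
  congr 1
  by_cases h : s + t = 0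
  · simp only [h, and_true, mul_ite, mul_zero, Finset.sum_ite_eq',
      Finset.mem_univ, if_true,
      Finset.mul_sum]
    exact Finset.sum_congr rfl fun k _ => by ring
  · simp [h]

theorem locFin_nordMul_aLin_starLin (i j k l : ℕ) (h : l ≤ r → j ≤ r) (u : ℤ) :
    LocFin fun s => nordMul (0 ≤ s ∧ l ≤ r) (aLin n r i j s) (starLin n r k l (u - s)) := by
  by_cases hl : l ≤ r
  · simp only [nordMul_congr (and_iff_left hl)]
    exact (evZero_aLin i j (h hl)).locFin_nordMul (evZero_starLin k l) 0 u
  · simp only [nordMul, hl, and_false, if_false]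
    exact ((locFin_starLin k l (not_le.mp hl)).comp_injective
      (sub_right_injective (b := u))).mul_left _

/-- The mode `u` of the normally ordered product `:a_{kl}(z) a*_{kl}(z):`. -/
noncomputable def modeLin (n r k l : ℕ) (u : ℤ) : Module.End ℂ (FSp n) :=
  lfSum fun s => nordMul (0 ≤ s ∧ l ≤ r) (aLin n r k l s) (starLin n r k l (u - s))

theorem coe_modeLin (n r k l : ℕ) (u : ℤ) : ⇑(modeLin n r k l u) = nAAmode n r k l k l u := by
  funext q
  rw [modeLin, lfSum_apply (locFin_nordMul_aLin_starLin k l k l id u)]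
  refine finsum_congr fun s => ?_
  unfold nordMul nAA
  rw [← coe_aLin, ← coe_starLin]
  split_ifs <;> rfl

theorem evZero_modeLin (k : ℕ) {l : ℕ} (hl : l ≤ r) : EvZero (modeLin n r k l) := by
  have h : modeLin n r k l = fun u => lfSum fun s =>
      nordMul (0 ≤ s) (aLin n r k l s) (starLin n r k l (u - s)) := by
    funext u
    simp only [modeLin, nordMul_congr (and_iff_left hl)]
  rw [h]
  exact (evZero_aLin k l hl).lfSum_nordMul (evZero_starLin k l) 0

theorem lie_modeLin_starLin {k l : ℕ} (hkl : 1 ≤ k ∧ k ≤ l ∧ l ≤ n) (k' l' : ℕ) (m s : ℤ) :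
    ⁅modeLin n r k l m, starLin n r k' l' s⁆
      = (if k = k' ∧ l = l' then (1 : ℂ) else 0) • starLin n r k' l' (s + m) := by
  have h (t : ℤ) : ⁅starLin n r k' l' s, nordMul (0 ≤ t ∧ l ≤ r) (aLin n r k l t)
      (starLin n r k l (m - t))⁆
      = (-if (k = k' ∧ l = l') ∧ t + s = 0 then (1 : ℂ) else 0) • starLin n r k l (m - t) := by
    rw [lie_nordMul (β := 0) _ (by rw [← endLie_skew, lie_aLin_starLin hkl, neg_smul_end])
      (by rw [lie_starLin_starLin, zero_smul]), zero_smul, add_zero]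
  rw [← endLie_skew, modeLin, lie_lfSum (locFin_nordMul_aLin_starLin k l k l id m)]
  simp only [h]
  rw [lfSum_single (t := -s) fun t ht => by rw [if_neg (by omega), neg_zero, zero_smul],
    neg_smul_end, neg_neg, neg_add_cancel, sub_neg_eq_add, add_comm s m]
  split_ifs with h1 h2 h2
  · rw [h2.1, h2.2]
  · exact absurd h1.1 h2
  · exact absurd ⟨h2, rfl⟩ h1
  · rw [zero_smul, zero_smul]

theorem lie_modeLin_aLin (k l : ℕ) {k' l' : ℕ} (hkl : 1 ≤ k' ∧ k' ≤ l' ∧ l' ≤ n) (m s : ℤ) :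
    ⁅modeLin n r k l m, aLin n r k' l' s⁆
      = (if k = k' ∧ l = l' then (-1 : ℂ) else 0) • aLin n r k' l' (s + m) := by
  have h (t : ℤ) : ⁅aLin n r k' l' s, nordMul (0 ≤ t ∧ l ≤ r) (aLin n r k l t)
      (starLin n r k l (m - t))⁆
      = (if (k' = k ∧ l' = l) ∧ s + (m - t) = 0 then (1 : ℂ) else 0) • aLin n r k l t := by
    rw [lie_nordMul (α := 0) _ (by rw [lie_aLin_aLin, zero_smul]) (lie_aLin_starLin hkl _ _ _ _),
      zero_smul, zero_add]
  rw [← endLie_skew, modeLin, lie_lfSum (locFin_nordMul_aLin_starLin k l k l id m)]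
  simp only [h]
  rw [lfSum_single (t := s + m) fun t ht => by rw [if_neg (by omega), zero_smul]]
  split_ifs with h1 h2 h2
  · rw [h2.1, h2.2, neg_smul_end]
  · omega
  · omega
  · rw [zero_smul, zero_smul, neg_zero]

theorem lie_bLin_modeLin (e : ℕ → ℕ → ℂ) (lam : ℕ → ℂ) (i k l : ℕ) (s m : ℤ) :
    ⁅bLin n e lam i s, modeLin n r k l m⁆ = 0 := by
  have h (t : ℤ) : ⁅bLin n e lam i s, nordMul (0 ≤ t ∧ l ≤ r) (aLin n r k l t)
      (starLin n r k l (m - t))⁆ = 0 := by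
    rw [lie_nordMul (α := 0) (β := 0) _ (by rw [lie_bLin_aLin, zero_smul])
      (by rw [lie_bLin_starLin, zero_smul]), zero_smul, zero_smul, add_zero]
  rw [modeLin, lie_lfSum (locFin_nordMul_aLin_starLin k l k l id m)]
  simp only [h]
  exact lfSum_single (t := 0) fun _ _ => rfl

/-- `rhoH` as a linear map. -/
noncomputable def rhoHLin (n r : ℕ) (e : ℕ → ℕ → ℂ) (lam : ℕ → ℂ) (i : ℕ) (m : ℤ) :
    Module.End ℂ (FSp n) :=
  (2 : ℂ) • modeLin n r i i m
    + ∑ j ∈ Finset.Ico 1 i, (modeLin n r j i m - modeLin n r j (i - 1) m)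
    + ∑ j ∈ Finset.Icc (i + 1) n, (modeLin n r i j m - modeLin n r (i + 1) j m)
    + bLin n e lam i m

theorem coe_rhoHLin (n r : ℕ) (e : ℕ → ℕ → ℂ) (lam : ℕ → ℂ) (i : ℕ) (m : ℤ) :
    ⇑(rhoHLin n r e lam i m) = rhoH n r e lam i m := by
  funext q
  simp only [rhoHLin, rhoH, LinearMap.add_apply, LinearMap.smul_apply, LinearMap.sum_apply,
    LinearMap.sub_apply, coe_modeLin, coe_bLin]

/-- The pairing of the simple root `α_i` with the root `α_k + ⋯ + α_l`. -/
noncomputable def rootWt (i k l : ℕ) : ℂ :=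
  (if i = k then 1 else 0) + (if i = l then 1 else 0) - (if i = l + 1 then 1 else 0)
    - (if i + 1 = k then 1 else 0)

theorem rootWt_eq_sum {i k l : ℕ} (hi : 1 ≤ i) (hkl : 1 ≤ k ∧ k ≤ l ∧ l ≤ n)
    (c : ℂ) : 2 * (if i = k ∧ i = l then c else 0)
      + ∑ j ∈ Finset.Ico 1 i,
          ((if j = k ∧ i = l then c else 0) - if j = k ∧ i - 1 = l then c else 0)
      + ∑ j ∈ Finset.Icc (i + 1) n,
          ((if i = k ∧ j = l then c else 0) - if i + 1 = k ∧ j = l then c else 0)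
      = rootWt i k l * c := by
  have h (a : ℕ) : (∑ j ∈ Finset.Ico 1 i, if j = k ∧ a = l then c else 0)
      = if k < i ∧ a = l then c else 0 := by
    simp only [ite_and, Finset.sum_ite_eq', Finset.mem_Ico, hkl.1, if_true]
  have h' (a : ℕ) : (∑ j ∈ Finset.Icc (i + 1) n, if a = k ∧ j = l then c else 0)
      = if a = k ∧ i < l then c else 0 := by
    simp only [and_comm (a := a = k), ite_and, Finset.sum_ite_eq', Finset.mem_Icc, hkl.2.2,
      if_true, Nat.succ_le_iff]
  rw [Finset.sum_sub_distrib, Finset.sum_sub_distrib, h, h, h', h', rootWt]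
  rcases lt_trichotomy i l with h1 | h1 | h1 <;> rcases lt_trichotomy i k with h2 | h2 | h2 <;>
    first
    | omega
    | (simp only [h1.ne, h2.ne, h1.ne', h2.ne', h1, h2, and_false, and_true, true_and, false_and,
        if_false, h1.not_gt, h2.not_gt, and_self]
       split_ifs <;> first | omega | ring)
    | (split_ifs <;> first | omega | ring)

theorem lie_rhoHLin_of_forall {e : ℕ → ℕ → ℂ} {lam : ℕ → ℂ} {i k l : ℕ} {m : ℤ} (hi : 1 ≤ i)
    (hi' : i ≤ n) (hkl : 1 ≤ k ∧ k ≤ l ∧ l ≤ n) {x y z : Module.End ℂ (FSp n)} {c : ℂ}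
    (h : ∀ k' l', (1 ≤ k' ∧ k' ≤ l' ∧ l' ≤ n) →
      ⁅modeLin n r k' l' m, x⁆ = (if k' = k ∧ l' = l then c else 0) • y)
    (hb : ⁅bLin n e lam i m, x⁆ = z) :
    ⁅rhoHLin n r e lam i m, x⁆ = (rootWt i k l * c) • y + z := by
  rw [rhoHLin, add_endLie, hb, add_endLie, add_endLie, smul_endLie, sum_endLie, sum_endLie,
    h i i ⟨hi, le_rfl, hi'⟩, ← rootWt_eq_sum hi hkl, add_smul, add_smul, Finset.sum_smul,
    Finset.sum_smul, smul_smul]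
  congr 2
  · congr 1
    refine Finset.sum_congr rfl fun j hj => ?_
    rw [Finset.mem_Ico] at hj
    rw [sub_endLie, h j i (by omega), h j (i - 1) (by omega), sub_smul]
  · refine Finset.sum_congr rfl fun j hj => ?_
    rw [Finset.mem_Icc] at hj
    rw [sub_endLie, h i j (by omega), h (i + 1) j (by omega), sub_smul]

section Brackets

variable (r) (e : ℕ → ℕ → ℂ) (lam : ℕ → ℂ)

theorem lie_rhoHLin_starLin {i k l : ℕ} (hi : 1 ≤ i) (hi' : i ≤ n)
    (hkl : 1 ≤ k ∧ k ≤ l ∧ l ≤ n) (m s : ℤ) :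
    ⁅rhoHLin n r e lam i m, starLin n r k l s⁆ = rootWt i k l • starLin n r k l (s + m) := by
  rw [lie_rhoHLin_of_forall hi hi' hkl (fun k' l' h => lie_modeLin_starLin h k l m s)
    (lie_bLin_starLin ..), mul_one, add_zero]

theorem lie_rhoHLin_aLin {i k l : ℕ} (hi : 1 ≤ i) (hi' : i ≤ n)
    (hkl : 1 ≤ k ∧ k ≤ l ∧ l ≤ n) (m s : ℤ) :
    ⁅rhoHLin n r e lam i m, aLin n r k l s⁆ = (-rootWt i k l) • aLin n r k l (s + m) := by
  rw [lie_rhoHLin_of_forall hi hi' hkl (fun k' l' h => lie_modeLin_aLin k' l' hkl m s)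
    (lie_bLin_aLin ..), mul_neg_one, add_zero]

theorem lie_rhoHLin_bLin {i : ℕ} (hi : 1 ≤ i) (hi' : i ≤ n) (j : ℕ) (m s : ℤ) :
    ⁅rhoHLin n r e lam i m, bLin n e lam j s⁆ =
      (if m + s = 0 then m * ∑ k : Fin n, e i (k.1 + 1) * e j (k.1 + 1) else 0 : ℂ) • 1 := by
  rw [lie_rhoHLin_of_forall (y := 0) (c := 0) hi hi' ⟨hi, le_rfl, hi'⟩ (fun k' l' h => by
    rw [← endLie_skew, lie_bLin_modeLin, neg_zero, smul_zero]) (lie_bLin_bLin ..), smul_zero,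
    zero_add]

theorem hasShiftDefect_and_le (a : ℤ) (l r : ℕ) (m : ℤ) :
    HasShiftDefect (fun s => a ≤ s ∧ l ≤ r) m (if l ≤ r then (-m : ℂ) else 0) := by
  split_ifs with hl
  · exact (hasShiftDefect_le a m).congr fun s => and_iff_left hl
  · exact (hasShiftDefect_const False m).congr fun s => by simp [hl]

theorem lie_rhoHLin_modeLin {i k l : ℕ} (hi : 1 ≤ i) (hi' : i ≤ n)
    (hkl : 1 ≤ k ∧ k ≤ l ∧ l ≤ n) (m s : ℤ) :
    ⁅rhoHLin n r e lam i m, modeLin n r k l s⁆ =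
      (if m + s = 0 then rootWt i k l * (if l ≤ r then (-m : ℂ) else 0) else 0 : ℂ) • 1 := by
  rw [modeLin, lie_lfSum_nordMul (rhoHLin n r e lam i m) _ _
    (fun s => (if s = 0 then (-1 : ℂ) else 0) • 1) (fun s => 0 ≤ s ∧ l ≤ r) m
    (β := rootWt i k l) (κ := 0)
    (lie_rhoHLin_aLin r e lam hi hi' hkl m)
    (fun s => by
      rw [lie_rhoHLin_starLin r e lam hi hi' hkl m, ite_self, zero_smul, add_zero])
    (fun s u => by
      rw [← endLie_skew, lie_aLin_starLin hkl, neg_smul_end]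
      split_ifs <;> first | omega | simp)
    (locFin_nordMul_aLin_starLin k l k l id) (hasShiftDefect_and_le 0 l r m) s]
  rw [neg_add_cancel, zero_smul, zero_smul, zero_add, add_zero, smul_smul]
  congr 1
  split_ifs <;> ring

end Brackets

/-- The field inside the cubic term of `rhoE`. -/
noncomputable def cubicLin (n r j : ℕ) (u : ℤ) : Module.End ℂ (FSp n) :=
  ∑ k ∈ Finset.Ico 1 j, modeLin n r k (j - 1) u - ∑ k ∈ Finset.Icc 1 j, modeLin n r k j u

theorem evZero_cubicLin {j : ℕ} (hj : j ≤ r) : EvZero (cubicLin n r j) :=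
  (EvZero.sum _ fun k _ => evZero_modeLin k (by omega)).sub
    (EvZero.sum _ fun k _ => evZero_modeLin k hj)

theorem lie_cubicLin_starLin {j : ℕ} (hj : 1 ≤ j) (hj' : j ≤ n) (u s : ℤ) :
    ⁅cubicLin n r j u, starLin n r j j s⁆ = -starLin n r j j (s + u) := by
  rw [cubicLin, sub_endLie, sum_endLie, sum_endLie, Finset.sum_eq_zero, zero_sub,
    Finset.sum_eq_single_of_mem j (Finset.right_mem_Icc.mpr hj),
    lie_modeLin_starLin ⟨hj, le_rfl, hj'⟩, if_pos ⟨rfl, rfl⟩, one_smul]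
  · intro k hk hne
    rw [Finset.mem_Icc] at hk
    rw [lie_modeLin_starLin ⟨hk.1, hk.2, hj'⟩, if_neg fun h => hne h.1, zero_smul]
  · intro k hk
    rw [Finset.mem_Ico] at hk
    rw [lie_modeLin_starLin (by omega), if_neg (by omega), zero_smul]

/-- The pairing of `α_i` with the sum of all `α_k + ⋯ + α_l`, `1 ≤ k ≤ l`. -/
noncomputable def colWt (i l : ℕ) : ℂ :=
  (if i = l then (l : ℂ) + 1 else 0) - if i = l + 1 then (l : ℂ) else 0

theorem sum_rootWt {i : ℕ} (hi : 1 ≤ i) (l : ℕ) :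
    ∑ k ∈ Finset.Icc 1 l, rootWt i k l = colWt i l := by
  simp only [rootWt, colWt, Finset.sum_sub_distrib, Finset.sum_add_distrib, Finset.sum_ite_eq,
    Finset.mem_Icc, Finset.sum_const, Nat.card_Icc, add_tsub_cancel_right, nsmul_eq_mul, hi,
    true_and, le_add_iff_nonneg_left, zero_le]
  split_ifs <;> first | omega | ring

/-- The anomaly in the bracket of `rhoHLin` with `cubicLin`. -/
noncomputable def cubicLevel (r i j : ℕ) : ℂ :=
  (if j - 1 ≤ r then colWt i (j - 1) else 0) - if j ≤ r then colWt i j else 0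

theorem lie_rhoHLin_cubicLin (r : ℕ) (e : ℕ → ℕ → ℂ) (lam : ℕ → ℂ) {i j : ℕ} (hi : 1 ≤ i)
    (hi' : i ≤ n) (hj : 1 ≤ j) (hj' : j ≤ n) (m s : ℤ) :
    ⁅rhoHLin n r e lam i m, cubicLin n r j s⁆
      = (if m + s = 0 then -m * cubicLevel r i j else 0 : ℂ) • 1 := by
  have h (l : ℕ) (hl : l ≤ n) : ∑ k ∈ Finset.Icc 1 l, ⁅rhoHLin n r e lam i m, modeLin n r k l s⁆
      = (if m + s = 0 then -m * (if l ≤ r then colWt i l else 0) else 0 : ℂ) • 1 := by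
    rw [Finset.sum_congr rfl fun k hk => lie_rhoHLin_modeLin r e lam hi hi'
      (by rw [Finset.mem_Icc] at hk; exact ⟨hk.1, hk.2, hl⟩) m s, ← Finset.sum_smul]
    congr 1
    split_ifs
    · rw [← Finset.sum_mul, sum_rootWt hi, mul_comm]
    · simp
    · simp
  have hIco : Finset.Ico 1 j = Finset.Icc 1 (j - 1) := by
    ext k
    simp only [Finset.mem_Ico, Finset.mem_Icc]
    omega
  rw [cubicLin, endLie_sub, endLie_sum, endLie_sum, hIco, h (j - 1) (by omega), h j hj',
    smul_sub_smul_end, cubicLevel]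
  congr 1
  split_ifs <;> ring

theorem rootWt_self (i j : ℕ) : rootWt i j j = cartanEntry i j := by
  unfold rootWt cartanEntry
  split_ifs <;> first | omega | norm_num

theorem rootWt_sub_rootWt_succ {i j k : ℕ} (hk : j + 1 ≤ k) :
    -rootWt i (j + 1) k + rootWt i j k = cartanEntry i j := by
  unfold rootWt cartanEntry
  split_ifs <;> first | omega | norm_num

theorem rootWt_sub_rootWt_pred {i j k : ℕ} (hk : k < j) :
    -rootWt i k (j - 1) + rootWt i k j = cartanEntry i j := by
  unfold rootWt cartanEntry
  split_ifs <;> first | omega | norm_num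

/-- The coefficient of the derivative term in `rhoE`. -/
noncomputable def derivCoeff (r : ℕ) (γ : ℂ) (j : ℕ) : ℂ :=
  (if r < j then (r : ℂ) + 1 else (j : ℂ) + 1) - γ ^ 2

/-- Cancellation of the anomalies in the bracket of `rhoH` with `rhoE`. -/
theorem anomaly_cancel (r : ℕ) (γ : ℂ) (i : ℕ) {j : ℕ} (hj : 1 ≤ j) :
    cartanEntry i j * (if j ≤ r then 1 else 0) - cubicLevel r i j - Bentry r γ i j
      = cartanEntry i j * derivCoeff r γ j := by
  obtain ⟨l, rfl⟩ := Nat.exists_eq_add_of_le' hj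
  simp only [cubicLevel, Bentry, derivCoeff, colWt, add_tsub_cancel_right]
  rcases lt_trichotomy l r with h | rfl | h
  · have h1 : l + 1 ≤ r := h
    have h2 : ¬ r < l + 1 := by omega
    simp only [h1, h.le, h2, if_true, if_false, h.ne, cartanEntry, add_left_inj]
    push_cast
    split_ifs <;> first | omega | ring
  · simp only [le_refl, lt_add_iff_pos_right, zero_lt_one, if_true, cartanEntry,
      show ¬ l + 1 ≤ l by omega, if_false]
    split_ifs <;> first | omega | ring
  · have h1 : ¬ l ≤ r := by omega
    have h2 : ¬ l + 1 ≤ r := by omega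
    have h3 : r < l + 1 := by omega
    simp only [h1, h2, h3, if_true, if_false, h.ne', cartanEntry, add_left_inj]
    split_ifs <;> first | omega | ring

theorem locFin_aLin_mul_starLin {i j : ℕ} (hij : 1 ≤ i ∧ i ≤ j ∧ j ≤ n) {k l : ℕ}
    (h : l ≤ r → j ≤ r) (hne : ¬(i = k ∧ j = l)) (u : ℤ) :
    LocFin fun s => aLin n r i j s * starLin n r k l (u - s) :=
  LocFin.mul_of_commute (fun s => by
    rw [lie_aLin_starLin hij, if_neg fun h => hne h.1, zero_smul])
    (locFin_nordMul_aLin_starLin i j k l h u)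

theorem locFin_starLin_mul_bLin (e : ℕ → ℕ → ℂ) (lam : ℕ → ℂ) (j : ℕ) (u : ℤ) :
    LocFin fun s => starLin n r j j s * bLin n e lam j (u - s) :=
  LocFin.mul_of_commute (fun s => by rw [← endLie_skew, lie_bLin_starLin, neg_zero])
    ((evZero_starLin j j).locFin_nordMul (evZero_bLin e lam j) 0 u)

theorem locFin_nordMul_starLin_cubicLin (j : ℕ) (u : ℤ) :
    LocFin fun s => nordMul ((j ≤ r ∧ 0 < s) ∨ r < j) (starLin n r j j s)
      (cubicLin n r j (u - s)) := by
  rcases le_or_gt j r with hj | hj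
  · have h (s : ℤ) : (j ≤ r ∧ 0 < s) ∨ r < j ↔ 1 ≤ s := by omega
    simp only [nordMul_congr (h _)]
    exact (evZero_starLin j j).locFin_nordMul (evZero_cubicLin hj) 1 u
  · simp only [nordMul, hj, or_true, if_true]
    exact (locFin_starLin j j hj).mul_left _

/-- `rhoE` as a linear map. -/
noncomputable def rhoELin (n r : ℕ) (γ : ℂ) (e : ℕ → ℕ → ℂ) (lam : ℕ → ℂ) (j : ℕ) (p : ℤ) :
    Module.End ℂ (FSp n) :=
  lfSum (fun s => nordMul ((j ≤ r ∧ 0 < s) ∨ r < j) (starLin n r j j s) (cubicLin n r j (p - s)))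
    + ∑ k ∈ Finset.Icc (j + 1) n, lfSum (fun s => aLin n r (j + 1) k s * starLin n r j k (p - s))
    - ∑ k ∈ Finset.Ico 1 j, lfSum (fun s => aLin n r k (j - 1) s * starLin n r k j (p - s))
    - lfSum (fun s => starLin n r j j s * bLin n e lam j (p - s))
    - derivCoeff r γ j • ((-(p : ℂ)) • starLin n r j j p)

theorem coe_rhoELin (r : ℕ) (γ : ℂ) (e : ℕ → ℕ → ℂ) (lam : ℕ → ℂ) {j : ℕ} (hj : 1 ≤ j)
    (hj' : j ≤ n) (p : ℤ) : ⇑(rhoELin n r γ e lam j p) = rhoE n r γ e lam j p := by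
  funext q
  simp only [rhoELin, rhoE, LinearMap.add_apply, LinearMap.smul_apply, LinearMap.sum_apply,
    LinearMap.sub_apply, coe_starLin, derivCoeff]
  have h1 (s : ℤ) : nordMul ((j ≤ r ∧ 0 < s) ∨ r < j) (starLin n r j j s)
      (cubicLin n r j (p - s)) q = nStar n r j j s
        ((∑ k ∈ Finset.Ico 1 j, nAAmode n r k (j - 1) k (j - 1) (p - s))
          - ∑ k ∈ Finset.Icc 1 j, nAAmode n r k j k j (p - s)) q := by
    have h : ⇑(cubicLin n r j (p - s)) =
        (∑ k ∈ Finset.Ico 1 j, nAAmode n r k (j - 1) k (j - 1) (p - s))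
          - ∑ k ∈ Finset.Icc 1 j, nAAmode n r k j k j (p - s) := by
      funext q
      simp only [cubicLin, LinearMap.sub_apply, LinearMap.sum_apply, coe_modeLin, Pi.sub_apply,
        Finset.sum_apply]
    unfold nordMul nStar
    rw [← h, ← coe_starLin]
    split_ifs <;> rfl
  have h2 (k : ℕ) (hk : k ∈ Finset.Icc (j + 1) n) :
      lfSum (fun s => aLin n r (j + 1) k s * starLin n r j k (p - s)) q
        = ∑ᶠ s : ℤ, aop n r (j + 1) k s (astarop n r j k (p - s) q) := by
    rw [Finset.mem_Icc] at hk
    rw [lfSum_apply (locFin_aLin_mul_starLin (by omega) id (by omega) p)]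
    simp only [Module.End.mul_apply, coe_aLin, coe_starLin]
  have h3 (k : ℕ) (hk : k ∈ Finset.Ico 1 j) :
      lfSum (fun s => aLin n r k (j - 1) s * starLin n r k j (p - s)) q
        = ∑ᶠ s : ℤ, aop n r k (j - 1) s (astarop n r k j (p - s) q) := by
    rw [Finset.mem_Ico] at hk
    rw [lfSum_apply (locFin_aLin_mul_starLin (by omega) (by omega) (by omega) p)]
    simp only [Module.End.mul_apply, coe_aLin, coe_starLin]
  rw [lfSum_apply (locFin_nordMul_starLin_cubicLin j p),
    lfSum_apply (locFin_starLin_mul_bLin e lam j p), finsum_congr h1, Finset.sum_congr rfl h2,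
    Finset.sum_congr rfl h3]
  simp only [Module.End.mul_apply, coe_starLin, coe_bLin]

theorem lie_rhoHLin_rhoELin (r : ℕ) (γ : ℂ) (e : ℕ → ℕ → ℂ) (lam : ℕ → ℂ) {i j : ℕ} (hi : 1 ≤ i)
    (hi' : i ≤ n) (hj : 1 ≤ j) (hj' : j ≤ n)
    (he : ∑ k : Fin n, e i (k.1 + 1) * e j (k.1 + 1) = Bentry r γ i j) (m p : ℤ) :
    ⁅rhoHLin n r e lam i m, rhoELin n r γ e lam j p⁆
      = cartanEntry i j • rhoELin n r γ e lam j (m + p) := by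
  have hstar {k l : ℕ} (h : 1 ≤ k ∧ k ≤ l ∧ l ≤ n) (u : ℤ) :
      ⁅rhoHLin n r e lam i m, starLin n r k l u⁆ = rootWt i k l • starLin n r k l (u + m)
        + (if m + u = 0 then (0 : ℂ) else 0) • 1 := by
    rw [lie_rhoHLin_starLin r e lam hi hi' h, ite_self, zero_smul, add_zero]
  have hann : HasShiftDefect (fun s : ℤ => (j ≤ r ∧ 0 < s) ∨ r < j) m
      (if j ≤ r then (-m : ℂ) else 0) := by
    split_ifs with h
    · exact (hasShiftDefect_le 1 m).congr fun s => by omega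
    · exact (hasShiftDefect_const True m).congr fun s => by simp; omega
  have h1 := lie_lfSum_nordMul (rhoHLin n r e lam i m) (starLin n r j j) (cubicLin n r j)
    (fun s => -starLin n r j j s) (fun s => (j ≤ r ∧ 0 < s) ∨ r < j) m (β := 0)
    (lie_rhoHLin_starLin r e lam hi hi' ⟨hj, le_rfl, hj'⟩ m)
    (fun u => by rw [lie_rhoHLin_cubicLin r e lam hi hi' hj hj' m u, zero_smul, zero_add])
    (fun s u => lie_cubicLin_starLin hj hj' u s)
    (locFin_nordMul_starLin_cubicLin j) hann p
  have h2 (k : ℕ) (hk : k ∈ Finset.Icc (j + 1) n) := by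
    rw [Finset.mem_Icc] at hk
    have := lie_lfSum_mul (rhoHLin n r e lam i m) (aLin n r (j + 1) k) (starLin n r j k) m
      (lie_rhoHLin_aLin r e lam hi hi' (by omega) m) (hstar (by omega))
      (fun s u => by rw [lie_aLin_starLin (by omega), if_neg (by omega), zero_smul])
      (locFin_aLin_mul_starLin (by omega) id (by omega)) p
    rwa [zero_smul, add_zero, rootWt_sub_rootWt_succ hk.1] at this
  have h3 (k : ℕ) (hk : k ∈ Finset.Ico 1 j) := by
    rw [Finset.mem_Ico] at hk
    have := lie_lfSum_mul (rhoHLin n r e lam i m) (aLin n r k (j - 1)) (starLin n r k j) m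
      (lie_rhoHLin_aLin r e lam hi hi' (by omega) m) (hstar (by omega))
      (fun s u => by rw [lie_aLin_starLin (by omega), if_neg (by omega), zero_smul])
      (locFin_aLin_mul_starLin (by omega) (by omega) (by omega)) p
    rwa [zero_smul, add_zero, rootWt_sub_rootWt_pred hk.2] at this
  have h4 := lie_lfSum_mul (rhoHLin n r e lam i m) (starLin n r j j) (bLin n e lam j) m (β := 0)
    (lie_rhoHLin_starLin r e lam hi hi' ⟨hj, le_rfl, hj'⟩ m)
    (fun u => by rw [lie_rhoHLin_bLin r e lam hi hi', he, zero_smul, zero_add])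
    (fun s u => by rw [← endLie_skew, lie_bLin_starLin, neg_zero])
    (locFin_starLin_mul_bLin e lam j) p
  have hc : (m : ℂ) * (cartanEntry i j * (if j ≤ r then 1 else 0) - cubicLevel r i j
      - Bentry r γ i j) = m * (cartanEntry i j * derivCoeff r γ j) := by
    rw [anomaly_cancel r γ i hj]
  have hν : (if j ≤ r then (-m : ℂ) else 0) = -m * if j ≤ r then 1 else 0 := by
    split_ifs <;> simp
  rw [rhoELin, endLie_sub, endLie_sub, endLie_sub, endLie_add, endLie_sum, endLie_sum, h1,
    Finset.sum_congr rfl h2, Finset.sum_congr rfl h3, h4, endLie_smul, endLie_smul,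
    lie_rhoHLin_starLin r e lam hi hi' ⟨hj, le_rfl, hj'⟩, rootWt_self, hν, add_comm p m, rhoELin,
    ← Finset.smul_sum, ← Finset.smul_sum, Int.cast_add]
  linear_combination (norm := module) hc • starLin n r j j (m + p)

end Modes

/-- relation (R2): `[ρ(H_i)_m, ρ(E_j)_p] = (α_i|α_j) · ρ(E_j)_{m+p}`. -/
theorem wakimoto_R2 (n r : ℕ) (γ : ℂ) (e : ℕ → ℕ → ℂ) (lam : ℕ → ℂ)
    (hn : 1 ≤ n) (hr : r ≤ n)
    (he : ∀ i j, 1 ≤ i → i ≤ n → 1 ≤ j → j ≤ n →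
      (∑ k : Fin n, e i (k.1 + 1) * e j (k.1 + 1)) = Bentry r γ i j)
    (i j : ℕ) (hi : 1 ≤ i) (hi' : i ≤ n) (hj : 1 ≤ j) (hj' : j ≤ n) (m p : ℤ) :
    opComm n (rhoH n r e lam i m) (rhoE n r γ e lam j p) =
      cartanEntry i j • rhoE n r γ e lam j (m + p) := by
  rw [← coe_rhoHLin, ← coe_rhoELin r γ e lam hj hj', ← coe_rhoELin r γ e lam hj hj']
  exact congrArg DFunLike.coe
    (lie_rhoHLin_rhoELin r γ e lam hi hi' hj hj' (he i j hi hi' hj hj') m p)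
end
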